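/- arXiv:2601.11083 — 2 statements merged into one kernel-verified Lean document; each statement's English description precedes it below -/
import Mathlib

section
/- Let k be a positive integer, and set k' = k if k is even and k' = k + 1 if k is odd. Let G be a canonical plumbing graph that fails Property X_k, does not contain C_{k'} as an induced subgraph, and has at least k' deep vertices. Then there exists a deep vertex g of G such that the configuration obtained as the subgraph of G induced by V(G) ∖ {g} fails Property X_k. Consequently, if moreover every subgraph of G induced by a proper subset of V(G) satisfies Property X_k, then G has at most k' − 1 deep vertices. -/
namespace LensPaper

/-- A finite weighted simple graph: the combinatorial data underlying a configuration
(a disjoint union of weighted linear graphs).  The fact that every connected component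
is a path is recorded separately by `Config.IsLinear`. -/
structure Config where
  V : Type
  fin : Fintype V
  deq : DecidableEq V
  graph : SimpleGraph V
  adjDec : DecidableRel graph.Adj
  w : V → ℤ

attribute [instance] Config.fin Config.deq Config.adjDec

namespace Config

/-- The degree of a vertex. -/
noncomputable def deg (C : Config) (v : C.V) : ℕ := (C.graph.neighborSet v).ncard

/-- A configuration: every component is a path, i.e. all degrees are at most `2` and the
graph is acyclic. -/
def IsLinear (C : Config) : Prop :=
  (∀ v : C.V, C.deg v ≤ 2) ∧ C.graph.IsAcyclic

/-- The adjusted weight `w'(v) = w(v) - deg(v)`. -/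
noncomputable def adjw (C : Config) (v : C.V) : ℤ := C.w v - C.deg v

/-- A vertex is bad if it is adjacent to two distinct vertices of positive adjusted
weight. -/
def IsBad (C : Config) (x : C.V) : Prop :=
  ∃ u v : C.V, u ≠ v ∧ C.graph.Adj x u ∧ C.graph.Adj x v ∧ 0 < C.adjw u ∧ 0 < C.adjw v

/-- A leaf: a vertex of degree at most one. -/
def IsLeaf (C : Config) (v : C.V) : Prop := C.deg v ≤ 1

/-- `v 0, v 1, …, v m` is a chain of consecutive (distinct) vertices. -/
def IsChain (C : Config) (m : ℕ) (v : ℕ → C.V) : Prop :=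
  (∀ i ≤ m, ∀ j ≤ m, v i = v j → i = j) ∧ ∀ i < m, C.graph.Adj (v i) (v (i + 1))

/-- The chain `v 0, …, v m` has the list `p` as its sequence of adjusted weights. -/
def ChainPattern (C : Config) (m : ℕ) (v : ℕ → C.V) (p : List ℤ) : Prop :=
  C.IsChain m v ∧ m + 1 = p.length ∧ ∀ i : Fin p.length, C.adjw (v i) = p.get i

/-- `Γ` contains a chain of consecutive vertices whose adjusted weights, read in order,
form the list `p`. -/
def HasPattern (C : Config) (p : List ℤ) : Prop := ∃ m v, C.ChainPattern m v p

/-- A chain realizing a bad-part pattern `p` (each entry of `p` is an adjusted weight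
together with a flag marking the bad positions): the chain has the prescribed adjusted
weights, and the bad vertices of the configuration are exactly the vertices of the chain
in the flagged positions. -/
def IsBadPartChain (C : Config) (p : List (ℤ × Bool)) (m : ℕ) (v : ℕ → C.V) : Prop :=
  C.IsChain m v ∧ m + 1 = p.length ∧
  (∀ i : Fin p.length, C.adjw (v i) = (p.get i).1) ∧
  (∀ x : C.V, C.IsBad x ↔ ∃ i : Fin p.length, (p.get i).2 = true ∧ v i = x)

end Config

/-- The chains of adjusted weights forbidden by Working Condition VI. -/
def forbiddenPatterns : List (List ℤ) :=
  [[1, 0, 0, 2], [1, 0, 0, 3], [1, 0, 0, 0, 3], [1, 1, 0, 0, 1, 2], [3, 1, 0, 0, 1],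
   [1, 0, 1, 2], [1, 0, 1, 3], [1, 1, 0, 2], [1, 1, 0, 1, 1, 2]]

/-- The bad-part patterns of Working Condition VII; `true` marks the bad positions. -/
def badPatterns : List (List (ℤ × Bool)) :=
  [[(1, false), (0, true), (1, false)],
   [(1, false), (0, true), (2, false)],
   [(1, false), (0, true), (3, false)],
   [(1, false), (1, true), (1, false)],
   [(1, false), (1, true), (2, false)],
   [(1, false), (2, true), (1, false)],
   [(1, false), (0, true), (1, false), (0, true), (1, false)],
   [(1, false), (0, true), (1, false), (0, true), (2, false)],
   [(1, false), (0, true), (1, false), (1, true), (1, false)],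
   [(1, false), (0, true), (1, false), (1, true), (2, false)],
   [(1, false), (1, true), (1, true), (1, false)],
   [(1, false), (1, true), (1, true), (1, true), (1, false)],
   [(1, false), (1, true), (2, true), (1, false)]]

namespace Config

/-- The Working Conditions (I)–(VII). -/
def WorkingConditions (C : Config) : Prop :=
  (∀ v : C.V, 2 ≤ C.w v) ∧
  (∀ v : C.V, C.adjw v ≤ 3) ∧
  (∀ u v : C.V, 1 < C.adjw u → 1 < C.adjw v → u = v) ∧
  (∀ v x : C.V, 1 < C.adjw v → C.IsBad x → C.adjw x = 1 → C.graph.Adj x v) ∧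
  ((∃ v : C.V, C.adjw v = 3) →
     ∀ u u' : C.V, C.graph.Adj u u' → C.adjw u = 1 → C.adjw u' = 1 → False) ∧
  (∀ u v x : C.V, C.graph.Adj u v → C.adjw u = 1 → C.adjw v = 1 →
     C.IsBad x → C.adjw x = 2 → C.graph.Adj x u ∨ C.graph.Adj x v) ∧
  (∀ p ∈ forbiddenPatterns, ¬ C.HasPattern p) ∧
  ((∃ x : C.V, C.IsBad x) → ∃ p ∈ badPatterns, ∃ m v, C.IsBadPartChain p m v)

end Config

/-- The standard inner product on `ℤ^N`. -/
def dot {N : ℕ} (x y : Fin N → ℤ) : ℤ := ∑ i, x i * y i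

/-- The support of a vector of `ℤ^N` with respect to the standard orthonormal basis. -/
def supp {N : ℕ} (x : Fin N → ℤ) : Finset (Fin N) :=
  Finset.univ.filter fun i => x i ≠ 0

namespace Config

/-- An embedding of a configuration into `ℤ^N`. -/
def IsEmbedding (C : Config) (N : ℕ) (φ : C.V → Fin N → ℤ) : Prop :=
  ∀ u v : C.V, dot (φ u) (φ v) =
    if u = v then C.w u else if C.graph.Adj u v then -1 else 0

/-- The restriction of `φ` to `S` is standard. -/
def IsStandardOn (C : Config) (N : ℕ) (φ : C.V → Fin N → ℤ) (S : Set C.V) : Prop :=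
  ∀ u ∈ S, ∀ v ∈ S,
    ((supp (φ u) ∩ supp (φ v)).card : ℤ) =
      if u = v then C.w v else if C.graph.Adj u v then 1 else 0

/-- A standard embedding. -/
def IsStandard (C : Config) (N : ℕ) (φ : C.V → Fin N → ℤ) : Prop :=
  C.IsStandardOn N φ Set.univ

/-- The restriction of `φ` to `S` is semi-standard at `x`. -/
def IsSemiStandardAtOn (C : Config) (N : ℕ) (φ : C.V → Fin N → ℤ) (x : C.V)
    (S : Set C.V) : Prop :=
  (∀ u ∈ S, ∀ v ∈ S,
    ((supp (φ u) ∩ supp (φ v)).card : ℤ) =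
      if u = v then C.w v
      else if C.graph.Adj u v then 1
      else if C.graph.Adj x u ∧ C.graph.Adj x v then 2
      else 0) ∧
  (∀ u ∈ S, ∀ v ∈ S, u ≠ v → C.graph.Adj x u → C.graph.Adj x v →
    (supp (φ u) ∩ supp (φ x) ∩ supp (φ v)).card = 1)

/-- A semi-standard embedding: semi-standard at some bad vertex. -/
def IsSemiStandard (C : Config) (N : ℕ) (φ : C.V → Fin N → ℤ) : Prop :=
  ∃ x : C.V, C.IsBad x ∧ C.IsSemiStandardAtOn N φ x Set.univ

/-- A candidate for the extended bad part: a chain containing the bad part whose two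
ends are either leaves or preceded by two consecutive vertices of vanishing adjusted
weight. -/
def IsEBPCand (C : Config) (m : ℕ) (v : ℕ → C.V) : Prop :=
  C.IsChain m v ∧
  (∀ p ∈ badPatterns, ∀ mb vb, C.IsBadPartChain p mb vb →
     ∀ i ≤ mb, ∃ j ≤ m, v j = vb i) ∧
  (C.IsLeaf (v 0) ∨ (2 ≤ m ∧ C.adjw (v 1) = 0 ∧ C.adjw (v 2) = 0)) ∧
  (C.IsLeaf (v m) ∨ (2 ≤ m ∧ C.adjw (v (m - 1)) = 0 ∧ C.adjw (v (m - 2)) = 0))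

/-- The extended bad part: a candidate with the fewest vertices. -/
def IsExtBadPart (C : Config) (m : ℕ) (v : ℕ → C.V) : Prop :=
  C.IsEBPCand m v ∧ ∀ m' v', C.IsEBPCand m' v' → m ≤ m'

/-- The set of vertices of the chain `v 0, …, v m`. -/
def ebpSet (C : Config) (m : ℕ) (v : ℕ → C.V) : Set C.V := {y | ∃ i ≤ m, v i = y}

/-- The outside part of `Γ` relative to the extended bad part `v 0, …, v m`. -/
def OutsidePart (C : Config) (m : ℕ) (v : ℕ → C.V) : Set C.V :=
  {x | ∀ i ≤ m, v i ≠ x}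
  ∪ {x | ¬ C.IsLeaf (v 0) ∧ (x = v 0 ∨ x = v 1 ∨ x = v 2)}
  ∪ {x | ¬ C.IsLeaf (v m) ∧ (x = v m ∨ x = v (m - 1) ∨ x = v (m - 2))}

/-- A screw at the front end of the extended bad part. -/
def IsFrontScrew (C : Config) (N : ℕ) (φ : C.V → Fin N → ℤ) (m : ℕ) (v : ℕ → C.V)
    (e : Fin N) : Prop :=
  ¬ C.IsLeaf (v 0) ∧ 3 ≤ m ∧ φ (v 2) e ≠ 0 ∧ φ (v 3) e ≠ 0

/-- A screw at the back end of the extended bad part. -/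
def IsBackScrew (C : Config) (N : ℕ) (φ : C.V → Fin N → ℤ) (m : ℕ) (v : ℕ → C.V)
    (e : Fin N) : Prop :=
  ¬ C.IsLeaf (v m) ∧ 3 ≤ m ∧ φ (v (m - 2)) e ≠ 0 ∧ φ (v (m - 3)) e ≠ 0

/-- All screws of `Γ` (with respect to `φ`) are clean. -/
def AllScrewsClean (C : Config) (N : ℕ) (φ : C.V → Fin N → ℤ) (m : ℕ)
    (v : ℕ → C.V) : Prop :=
  (∀ e : Fin N, C.IsFrontScrew N φ m v e →
    ∀ u : C.V, u ≠ v 2 → u ≠ v 3 → φ u e = 0) ∧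
  (∀ e : Fin N, C.IsBackScrew N φ m v e →
    ∀ u : C.V, u ≠ v (m - 2) → u ≠ v (m - 3) → φ u e = 0)

end Config
/-- The path graph on the disjoint union of the components encoded by a list of lists:
two vertices are adjacent iff they lie in the same component in consecutive
positions. -/
def ofListGraph (L : List (List ℤ)) :
    SimpleGraph ((i : Fin L.length) × Fin (L.get i).length) where
  Adj a b := a.1 = b.1 ∧ ((a.2 : ℕ) + 1 = (b.2 : ℕ) ∨ (b.2 : ℕ) + 1 = (a.2 : ℕ))
  symm := ⟨fun a b h => ⟨h.1.symm, h.2.symm⟩⟩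
  loopless := by
    constructor
    intro a h
    rcases h with ⟨-, h | h⟩ <;> omega

instance ofListGraphDec (L : List (List ℤ)) : DecidableRel (ofListGraph L).Adj :=
  fun a b => decidable_of_iff
    (a.1 = b.1 ∧ ((a.2 : ℕ) + 1 = (b.2 : ℕ) ∨ (b.2 : ℕ) + 1 = (a.2 : ℕ))) Iff.rfl

/-- The configuration (disjoint union of weighted paths) encoded by a list of
components, each component being the list of its weights read along the path. -/
def ofList (L : List (List ℤ)) : Config where
  V := (i : Fin L.length) × Fin (L.get i).length
  fin := inferInstance
  deq := inferInstance
  graph := ofListGraph L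
  adjDec := ofListGraphDec L
  w := fun a => (L.get a.1).get a.2

/-- `A` occurs as an induced subgraph of `B`: an injective, weight-preserving map
that preserves and reflects adjacency. -/
def IsInducedSubgraph (A B : Config) : Prop :=
  ∃ f : A.V → B.V, Function.Injective f ∧
    (∀ v, B.w (f v) = A.w v) ∧
    (∀ u v, A.graph.Adj u v ↔ B.graph.Adj (f u) (f v))

/-- `A` is (isomorphic to) the subgraph of `B` induced by the vertex set `S`. -/
def IsInducedOn (A B : Config) (S : Set B.V) : Prop :=
  ∃ f : A.V → B.V, Function.Injective f ∧
    (∀ v, B.w (f v) = A.w v) ∧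
    (∀ u v, A.graph.Adj u v ↔ B.graph.Adj (f u) (f v)) ∧
    Set.range f = S

/-- Negative continued fraction `[a₁,…,aₙ]⁻ = a₁ - 1/[a₂,…,aₙ]⁻` (the empty list is
sent to `0`; with the junk value `1/0 = 0` this gives `[aₙ]⁻ = aₙ`). -/
def negCF : List ℤ → ℚ
  | [] => 0
  | a :: l => (a : ℚ) - 1 / negCF l

/-- The (positive) sequences `a` and `b` are dual: for some coprime `p > q > 0`,
`[a]⁻ = p/q` and `[b]⁻ = p/(p-q)`. -/
def DualSeqs (a b : List ℤ) : Prop :=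
  a ≠ [] ∧ b ≠ [] ∧ (∀ x ∈ a, 2 ≤ x) ∧ (∀ x ∈ b, 2 ≤ x) ∧
  ∃ p q : ℤ, 0 < q ∧ q < p ∧ Int.gcd p q = 1 ∧
    negCF a = (p : ℚ) / (q : ℚ) ∧ negCF b = (p : ℚ) / ((p : ℚ) - (q : ℚ))

/-- `P` encodes a canonical plumbing graph (weights `≤ -2`) and `D` encodes its dual:
the components correspond to each other and each pair of weight sequences is dual. -/
def IsDualPair (P D : List (List ℤ)) : Prop :=
  ∃ h : P.length = D.length,
    ∀ i : Fin P.length,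
      DualSeqs ((P.get i).map fun x => -x) (D.get (Fin.cast h i))

/-- The total number of vertices encoded by a list of components. -/
def totalLen (L : List (List ℤ)) : ℕ := (L.map List.length).sum

/-- The canonical plumbing graph encoded by `P`, with dual encoded by `D`, fails
Property `X_k`: its dual admits an embedding into `ℤ^(n-k)`, where
`n = |V(G)| + |V(Γ)|`. -/
def FailsX (k : ℕ) (P D : List (List ℤ)) : Prop :=
  k ≤ totalLen P + totalLen D ∧
  ∃ φ : (ofList D).V → Fin (totalLen P + totalLen D - k) → ℤ,
    (ofList D).IsEmbedding (totalLen P + totalLen D - k) φ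

/-- The seventeen forbidden configurations of Theorem B (iii), encoded as lists of
path components. -/
def forbidden17 : List (List (List ℤ)) :=
  [[[-5, -2]], [[-6, -2, -2]], [[-2], [-2]], [[-3], [-2, -2]], [[-3, -2, -2, -3]],
   [[-3, -5, -3, -2]], [[-2, -2, -3, -5]], [[-4, -3, -2]], [[-3, -4, -2]],
   [[-4, -4, -2, -2]], [[-3, -4, -3, -3, -2]], [[-3, -3], [-2]], [[-3, -2, -3], [-3]],
   [[-4], [-4]], [[-4], [-3, -3]], [[-4], [-3, -2, -3]], [[-3, -3], [-3, -3]]]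

namespace Config

/-- A shallow vertex of a canonical plumbing graph. -/
def IsShallow (C : Config) (v : C.V) : Prop :=
  C.w v = -2 ∨ C.w v = -4 ∨
  (C.w v = -3 ∧ ∃ u, C.graph.Adj v u ∧ C.w u = -2) ∨
  (C.w v = -3 ∧ ∃ u, C.graph.Adj v u ∧ C.w u = -3)

/-- A deep vertex of a canonical plumbing graph. -/
def IsDeep (C : Config) (v : C.V) : Prop :=
  (5 ≤ |C.w v| ∧ ∀ u, C.graph.Adj v u → ¬ C.IsShallow u) ∨
  (C.w v = -3 ∧ ∀ u, ¬ C.graph.Adj v u)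

end Config

section Auxiliary

variable {N : ℕ}

/-- Increase the first entry of a list by one. -/
def incHead : List ℤ → List ℤ
  | [] => []
  | x :: l => (x + 1) :: l

/-- The dual of a sequence of integers `≥ 2`, by Riemenschneider's point rule. -/
def dualList : List ℤ → List ℤ
  | [] => [1]
  | a :: l => List.replicate (a - 2).toNat 2 ++ incHead (dualList l)

theorem incHead_ne_nil {l : List ℤ} (h : l ≠ []) : incHead l ≠ [] := by
  cases l <;> simp_all [incHead]

theorem negCF_incHead {l : List ℤ} (h : l ≠ []) : negCF (incHead l) = negCF l + 1 := by
  cases l with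
  | nil => exact absurd rfl h
  | cons x l => simp only [incHead, negCF]; push_cast; ring

theorem dualList_ne_nil (l : List ℤ) : dualList l ≠ [] := by
  induction l with
  | nil => simp [dualList]
  | cons a l ih => simp [dualList, incHead_ne_nil ih]

theorem negCF_replicate_two (n : ℕ) (t : List ℤ) (u : ℚ) (hu : 1 < u)
    (ht : negCF t = u / (u - 1)) :
    negCF (List.replicate n 2 ++ t) = (u + n) / (u + n - 1) := by
  induction n with
  | zero => simpa using ht
  | succ n ih =>
    have h0 : (0 : ℚ) ≤ n := Nat.cast_nonneg n
    have h1 : u + n - 1 ≠ 0 := by linarith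
    have h2 : u + n ≠ 0 := by linarith
    have h3 : u + (n + 1) - 1 ≠ 0 := by linarith
    simp only [List.replicate_succ, List.cons_append, negCF, ih]
    push_cast
    field_simp
    ring

theorem one_lt_negCF {l : List ℤ} (h : ∀ x ∈ l, 2 ≤ x) (hl : l ≠ []) : 1 < negCF l := by
  induction l with
  | nil => exact absurd rfl hl
  | cons a l ih =>
    have ha : (2 : ℚ) ≤ a := by exact_mod_cast h a (by simp)
    rcases eq_or_ne l [] with rfl | hne
    · simp [negCF]; linarith
    · have := ih (fun x hx => h x (by simp [hx])) hne
      have h1 : 1 / negCF l < 1 := by rw [div_lt_one (by linarith)]; exact this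
      simp only [negCF]; linarith

theorem negCF_dualList {l : List ℤ} (h : ∀ x ∈ l, 2 ≤ x) (hl : l ≠ []) :
    negCF (dualList l) = negCF l / (negCF l - 1) := by
  induction l with
  | nil => exact absurd rfl hl
  | cons a l ih =>
    have ha : 2 ≤ a := h a (by simp)
    have hcast : (((a - 2).toNat : ℕ) : ℚ) = a - 2 := by
      have : (((a - 2).toNat : ℕ) : ℤ) = a - 2 := Int.toNat_of_nonneg (by omega)
      exact_mod_cast this
    have key : negCF (incHead (dualList l)) =
        (2 - 1 / negCF l) / ((2 - 1 / negCF l) - 1) ∧ 1 < 2 - 1 / negCF l := by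
      rw [negCF_incHead (dualList_ne_nil l)]
      rcases eq_or_ne l [] with rfl | hne
      · norm_num [dualList, negCF]
      · have h' : ∀ x ∈ l, 2 ≤ x := fun x hx => h x (by simp [hx])
        have h1 := one_lt_negCF h' hne
        have h2 : 1 / negCF l < 1 := by rw [div_lt_one (by linarith)]; exact h1
        refine ⟨?_, by linarith⟩
        rw [ih h' hne]
        have h3 : negCF l - 1 ≠ 0 := by linarith
        have h4 : negCF l ≠ 0 := by linarith
        have h5 : 2 - 1 / negCF l - 1 ≠ 0 := by linarith
        have h6 : (2 : ℚ) - 1 / negCF l - 1 = (negCF l - 1) / negCF l := by field_simp; ring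
        rw [h6]
        field_simp
        ring
    rw [dualList, negCF_replicate_two _ _ _ key.2 key.1, hcast, negCF]
    congr 1 <;> ring

theorem two_le_of_mem_dualList {l : List ℤ} (h : ∀ x ∈ l, 2 ≤ x) (hl : l ≠ []) :
    ∀ x ∈ dualList l, 2 ≤ x := by
  induction l with
  | nil => exact absurd rfl hl
  | cons a l ih =>
    intro x hx
    simp only [dualList, List.mem_append, List.mem_replicate] at hx
    rcases hx with ⟨_, rfl⟩ | hx
    · exact le_refl _
    · rcases eq_or_ne l [] with rfl | hne
      · simp [dualList, incHead] at hx; omega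
      · have := ih (fun x hx => h x (by simp [hx])) hne
        cases hd : dualList l with
        | nil => exact absurd hd (dualList_ne_nil l)
        | cons y t =>
          rw [hd] at this hx
          simp only [incHead, List.mem_cons] at hx
          rcases hx with rfl | hx
          · have := this y (by simp); omega
          · exact this x (by simp [hx])

theorem negCF_injective {a b : List ℤ} (ha : ∀ x ∈ a, 2 ≤ x) (hb : ∀ x ∈ b, 2 ≤ x)
    (ha0 : a ≠ []) (hb0 : b ≠ []) (h : negCF a = negCF b) : a = b := by
  induction a generalizing b with
  | nil => exact absurd rfl ha0
  | cons x l ih =>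
    cases b with
    | nil => exact absurd rfl hb0
    | cons y l' =>
      have hl : ∀ x ∈ l, 2 ≤ x := fun x hx => ha x (by simp [hx])
      have hl' : ∀ x ∈ l', 2 ≤ x := fun x hx => hb x (by simp [hx])
      have bound : ∀ t : List ℤ, (∀ x ∈ t, 2 ≤ x) → 0 ≤ 1 / negCF t ∧ 1 / negCF t < 1 := by
        intro t ht
        rcases eq_or_ne t [] with rfl | hne
        · simp [negCF]
        · have := one_lt_negCF ht hne
          exact ⟨by positivity, by rw [div_lt_one (by linarith)]; exact this⟩
      obtain ⟨p1, p2⟩ := bound l hl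
      obtain ⟨q1, q2⟩ := bound l' hl'
      simp only [negCF] at h
      have hxy : x = y := by
        have h1 : (x : ℚ) < y + 1 := by linarith
        have h2 : (y : ℚ) < x + 1 := by linarith
        have h1' : x < y + 1 := by exact_mod_cast h1
        have h2' : y < x + 1 := by exact_mod_cast h2
        omega
      subst hxy
      have hv : negCF l = negCF l' := by
        have : 1 / negCF l = 1 / negCF l' := by linarith
        rw [one_div, one_div] at this
        exact inv_injective this
      rcases eq_or_ne l [] with rfl | hne
      · rcases eq_or_ne l' [] with rfl | hne'
        · rfl
        · have := one_lt_negCF hl' hne'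
          rw [← hv] at this; norm_num [negCF] at this
      · rcases eq_or_ne l' [] with rfl | hne'
        · have := one_lt_negCF hl hne
          rw [hv] at this; norm_num [negCF] at this
        · rw [ih hl hl' hne hne' hv]

theorem DualSeqs.eq_dualList {a b : List ℤ} (h : DualSeqs a b) : b = dualList a := by
  obtain ⟨ha0, hb0, ha, hb, p, q, hq, hqp, -, h1, h2⟩ := h
  refine negCF_injective hb (two_le_of_mem_dualList ha ha0) hb0 (dualList_ne_nil a) ?_
  rw [negCF_dualList ha ha0, h1, h2]
  have hq' : (0 : ℚ) < q := by exact_mod_cast hq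
  have hqp' : (q : ℚ) < p := by exact_mod_cast hqp
  have : (p : ℚ) / q - 1 = (p - q) / q := by field_simp
  have h3 : (p : ℚ) - q ≠ 0 := by linarith
  rw [this]
  field_simp

theorem dualSeqs_dualList {a : List ℤ} (ha0 : a ≠ []) (ha : ∀ x ∈ a, 2 ≤ x) :
    DualSeqs a (dualList a) := by
  have h1 := one_lt_negCF ha ha0
  have hden : (0 : ℚ) < (negCF a).den := by exact_mod_cast (negCF a).den_pos
  have heq : negCF a = ((negCF a).num : ℚ) / (((negCF a).den : ℤ) : ℚ) := by
    push_cast; exact (Rat.num_div_den _).symm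
  refine ⟨ha0, dualList_ne_nil a, ha, two_le_of_mem_dualList ha ha0,
    (negCF a).num, (negCF a).den, by exact_mod_cast (negCF a).den_pos, ?_, ?_, heq, ?_⟩
  · have : ((negCF a).den : ℚ) < (negCF a).num := by
      rw [heq, lt_div_iff₀ (by exact_mod_cast hden)] at h1
      push_cast at h1; linarith
    exact_mod_cast this
  · simpa [Int.gcd] using (negCF a).reduced
  · rw [negCF_dualList ha ha0]
    conv_lhs => rw [heq]
    have h3 : ((negCF a).num : ℚ) / (((negCF a).den : ℤ) : ℚ) - 1 =
        ((negCF a).num - (((negCF a).den : ℤ) : ℚ)) / (((negCF a).den : ℤ) : ℚ) := by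
      have : (((negCF a).den : ℤ) : ℚ) ≠ 0 := by push_cast; linarith
      field_simp
    rw [h3, div_div_div_cancel_right₀]
    push_cast; linarith

/-- The entries of the dual sequence record the gaps between consecutive slots, where
position `v` of a path carries as many slots as its weight exceeds its degree. -/
theorem exists_slot_positions {a b : List ℤ} (h : DualSeqs a b) :
    ∃ o : ℕ → ℕ, o 0 = 0 ∧ (∀ j (hj : j < b.length), (o (j + 1) : ℤ) = o j + b[j] - 2) ∧
      o b.length + 1 = a.length ∧
      ∀ v (hv : v < a.length), (Nat.count (fun j => o j = v) (b.length + 1) : ℤ) =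
        a[v] - (if 0 < v then 1 else 0) - (if v + 1 < a.length then 1 else 0) := by
  rw [h.eq_dualList]
  obtain ⟨ha0, -, ha, -⟩ := h
  clear b
  induction a with
  | nil => exact absurd rfl ha0
  | cons x l ih =>
    have hx : 2 ≤ x := ha x (by simp)
    obtain ⟨n, rfl⟩ : ∃ n : ℕ, x = n + 2 := ⟨(x - 2).toNat, by omega⟩
    rcases eq_or_ne l [] with rfl | hne
    · refine ⟨fun _ => 0, rfl, ?_, by simp, ?_⟩
      · intro j hj
        have : dualList [(n : ℤ) + 2] = List.replicate (n + 1) 2 := by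
          simp [dualList, incHead, List.replicate_succ']
        simp [this]
      · intro v hv
        have hv0 : v = 0 := by simpa using hv
        subst hv0
        simp [dualList, incHead, Nat.count_eq_card_filter_range]
        ring
    · obtain ⟨o, o0, ostep, oend, ocount⟩ := ih hne (fun x hx => ha x (by simp [hx]))
      obtain ⟨y, t, hd⟩ := List.exists_cons_of_ne_nil (dualList_ne_nil l)
      have hdual : dualList (((n : ℤ) + 2) :: l) = List.replicate n 2 ++ (y + 1) :: t := by
        simp [dualList, hd, incHead]
      rw [hd] at ostep oend ocount
      rw [hdual]
      have hstep0 := ostep 0 (by simp)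
      simp only [o0, List.getElem_cons_zero, zero_add, Nat.cast_zero] at hstep0
      let o' : ℕ → ℕ := fun j => if j ≤ n then 0 else o (j - n) + 1
      have o'1 : ∀ j ≤ n, o' j = 0 := fun j hj => by simp [o', hj]
      have o'2 : ∀ k, o' (n + 1 + k) = o (1 + k) + 1 := by
        intro k
        have h1 : ¬ n + 1 + k ≤ n := by omega
        have h2 : n + 1 + k - n = 1 + k := by omega
        simp [o', h2]
        omega
      refine ⟨o', o'1 0 (by omega), ?_, ?_, ?_⟩
      · intro j hj
        rcases lt_trichotomy j n with hlt | rfl | hgt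
        · rw [o'1 j (by omega), o'1 (j + 1) (by omega),
            List.getElem_append_left (by simpa using hlt)]
          simp
        · rw [o'1 j le_rfl, show j + 1 = j + 1 + 0 by omega, o'2,
            List.getElem_append_right (by simp)]
          simp
          omega
        · obtain ⟨k, rfl⟩ : ∃ k, j = n + 1 + k := ⟨j - n - 1, by omega⟩
          have hk : k < t.length := by
            simp at hj; omega
          have := ostep (k + 1) (by simpa using hk)
          rw [o'2, show n + 1 + k + 1 = n + 1 + (k + 1) by omega, o'2,
            List.getElem_append_right (by simp; omega)]
          have e : n + 1 + k - (List.replicate n (2 : ℤ)).length = k + 1 := by simp; omega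
          simp only [e, List.getElem_cons_succ] at this ⊢
          push_cast
          rw [show 1 + (k + 1) = k + 1 + 1 by omega, this, show 1 + k = k + 1 by omega]
          ring
      · have : (List.replicate n (2 : ℤ) ++ (y + 1) :: t).length = n + 1 + t.length := by
          simp; omega
        rw [this, o'2]
        simp at oend ⊢
        rw [show 1 + t.length = t.length + 1 by omega]; omega
      · intro v hv
        have hlen : (List.replicate n (2 : ℤ) ++ (y + 1) :: t).length + 1 =
            (n + 1) + (t.length + 1) := by simp; omega
        rw [hlen, Nat.count_add]
        have hc1 : Nat.count (fun j => o' j = v) (n + 1) = if v = 0 then n + 1 else 0 := by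
          rw [Nat.count_eq_card_filter_range]
          split_ifs with hv0
          · rw [Finset.filter_true_of_mem]
            · simp
            · intro j hj; rw [hv0]; exact o'1 j (by simp at hj; omega)
          · rw [Finset.card_eq_zero, Finset.filter_eq_empty_iff]
            intro j hj; rw [o'1 j (by simp at hj; omega)]; omega
        rw [hc1]
        simp only [o'2]
        rcases v with _ | v
        · simp [List.length_pos_iff, hne]
          ring
        · have hv' : v < l.length := by simpa using hv
          have := ocount v hv'
          rw [show (y :: t).length + 1 = 1 + (t.length + 1) by simp; omega, Nat.count_add] at this
          have hc0 : Nat.count (fun j => o j = v) 1 = if v = 0 then 1 else 0 := by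
            simp [Nat.count_succ, o0, eq_comm]
          rw [hc0] at this
          have e2 : (v + 1 + 1 < (((n : ℤ) + 2) :: l).length) ↔ v + 1 < l.length := by simp
          simp only [e2]
          simp only [Nat.add_right_cancel_iff, Nat.succ_ne_zero, if_false, List.getElem_cons_succ]
          push_cast at this ⊢
          rcases Nat.eq_zero_or_pos v with rfl | hp
          · simp at this ⊢; linarith
          · have : v ≠ 0 := by omega
            simp_all

section Dot

theorem dot_comm (x y : Fin N → ℤ) : dot x y = dot y x := by
  simp [dot, mul_comm]

theorem dot_add_left (x y z : Fin N → ℤ) : dot (x + y) z = dot x z + dot y z := by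
  simp [dot, add_mul, Finset.sum_add_distrib]

theorem dot_sub_left (x y z : Fin N → ℤ) : dot (x - y) z = dot x z - dot y z := by
  simp [dot, sub_mul, Finset.sum_sub_distrib]

theorem dot_smul_left (c : ℤ) (x z : Fin N → ℤ) : dot (c • x) z = c * dot x z := by
  simp [dot, Finset.mul_sum, mul_assoc]

theorem dot_add_right (x y z : Fin N → ℤ) : dot x (y + z) = dot x y + dot x z := by
  rw [dot_comm, dot_add_left, dot_comm y, dot_comm z]

theorem dot_sub_right (x y z : Fin N → ℤ) : dot x (y - z) = dot x y - dot x z := by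
  rw [dot_comm, dot_sub_left, dot_comm y, dot_comm z]

theorem dot_smul_right (c : ℤ) (x z : Fin N → ℤ) : dot x (c • z) = c * dot x z := by
  rw [dot_comm, dot_smul_left, dot_comm]

theorem dot_zero_left (z : Fin N → ℤ) : dot 0 z = 0 := by simp [dot]

theorem dot_sum_left {ι : Type*} (s : Finset ι) (x : ι → Fin N → ℤ) (z : Fin N → ℤ) :
    dot (∑ i ∈ s, x i) z = ∑ i ∈ s, dot (x i) z := by
  simp only [dot, Finset.sum_apply, Finset.sum_mul]
  exact Finset.sum_comm

theorem dot_sub_self (x y : Fin N → ℤ) :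
    dot (x - y) (x - y) = dot x x + dot y y - 2 * dot x y := by
  rw [dot_sub_left, dot_sub_right, dot_sub_right, dot_comm y x]
  ring

theorem dot_self_nonneg (x : Fin N → ℤ) : 0 ≤ dot x x :=
  Finset.sum_nonneg fun i _ => mul_self_nonneg (x i)

theorem eq_zero_of_dot_self {x : Fin N → ℤ} (h : dot x x = 0) : x = 0 := by
  funext i
  have := (Finset.sum_eq_zero_iff_of_nonneg (fun i _ => mul_self_nonneg (x i))).1 h i
    (Finset.mem_univ i)
  simpa using this

theorem sq_le_dot_self (x : Fin N → ℤ) (i : Fin N) : x i * x i ≤ dot x x :=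
  Finset.single_le_sum (f := fun i => x i * x i) (fun i _ => mul_self_nonneg (x i))
    (Finset.mem_univ i)

/-- A family of pairwise orthogonal unit vectors of `ℤ^N`. -/
def Orthon {ι : Type*} (f : ι → Fin N → ℤ) : Prop :=
  (∀ i, dot (f i) (f i) = 1) ∧ ∀ i j, i ≠ j → dot (f i) (f j) = 0

theorem Orthon.residual {ι : Type*} {f : ι → Fin N → ℤ} (hf : Orthon f)
    (s : Finset ι) (u : Fin N → ℤ) :
    dot (u - ∑ i ∈ s, dot u (f i) • f i) (u - ∑ i ∈ s, dot u (f i) • f i) =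
      dot u u - ∑ i ∈ s, dot u (f i) ^ 2 := by
  have h1 : ∀ z, dot (∑ i ∈ s, dot u (f i) • f i) z = ∑ i ∈ s, dot u (f i) * dot (f i) z := by
    intro z
    rw [dot_sum_left]
    simp only [dot_smul_left]
  have h2 : ∀ i ∈ s, dot (f i) (∑ j ∈ s, dot u (f j) • f j) = dot u (f i) := by
    intro i hi
    rw [dot_comm, h1, Finset.sum_eq_single_of_mem i hi, hf.1, mul_one]
    intro j _ hj
    rw [hf.2 j i hj, mul_zero]
  have h3 : dot (∑ i ∈ s, dot u (f i) • f i) (∑ i ∈ s, dot u (f i) • f i) =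
      ∑ i ∈ s, dot u (f i) ^ 2 := by
    rw [h1]
    exact Finset.sum_congr rfl fun i hi => by rw [h2 i hi]; ring
  have h4 : dot (∑ i ∈ s, dot u (f i) • f i) u = ∑ i ∈ s, dot u (f i) ^ 2 := by
    rw [h1]
    exact Finset.sum_congr rfl fun i _ => by rw [dot_comm (f i)]; ring
  rw [dot_sub_left, dot_sub_right, dot_sub_right, h3, h4, dot_comm u (∑ i ∈ s, _), h4]
  ring

theorem Orthon.bessel {ι : Type*} {f : ι → Fin N → ℤ} (hf : Orthon f)
    (s : Finset ι) (u : Fin N → ℤ) : ∑ i ∈ s, dot u (f i) ^ 2 ≤ dot u u := by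
  have := dot_self_nonneg (u - ∑ i ∈ s, dot u (f i) • f i)
  rw [hf.residual] at this
  linarith

theorem Orthon.eq_sum {ι : Type*} {f : ι → Fin N → ℤ} (hf : Orthon f)
    (s : Finset ι) (u : Fin N → ℤ) (h : dot u u ≤ ∑ i ∈ s, dot u (f i) ^ 2) :
    u = ∑ i ∈ s, dot u (f i) • f i := by
  have := dot_self_nonneg (u - ∑ i ∈ s, dot u (f i) • f i)
  have h0 := hf.residual s u
  exact sub_eq_zero.1 (eq_zero_of_dot_self (by linarith))

theorem orthon_three {a b c : Fin N → ℤ} (ha : dot a a = 1) (hb : dot b b = 1)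
    (hc : dot c c = 1) (hab : dot a b = 0) (hac : dot a c = 0) (hbc : dot b c = 0) :
    Orthon ![a, b, c] := by
  refine ⟨fun i => ?_, fun i j hij => ?_⟩
  · fin_cases i <;> assumption
  · have hba := dot_comm b a
    have hca := dot_comm c a
    have hcb := dot_comm c b
    fin_cases i <;> fin_cases j <;> simp_all

/-- Two roots at angle `π/3` share a signed coordinate vector. -/
theorem exists_common_unit {a b : Fin N → ℤ} (ha : dot a a = 2) (hb : dot b b = 2)
    (hab : dot a b = 1) : ∃ c, dot c c = 1 ∧ dot c a = 1 ∧ dot c b = 1 := by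
  obtain ⟨i, hi⟩ : ∃ i, 0 < a i * b i := by
    by_contra! hcon
    have : dot a b ≤ 0 := Finset.sum_nonpos fun i _ => hcon i
    omega
  have h1 := sq_le_dot_self a i
  have h2 := sq_le_dot_self b i
  rw [ha] at h1
  rw [hb] at h2
  have hs : ∀ (s : ℤ) (z : Fin N → ℤ), dot (Pi.single i s) z = s * z i := by
    intro s z
    simp [dot, Pi.single_apply]
  have a1 : a i ≤ 1 := by nlinarith
  have a2 : -1 ≤ a i := by nlinarith
  have b1 : b i ≤ 1 := by nlinarith
  have b2 : -1 ≤ b i := by nlinarith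
  refine ⟨Pi.single i (a i), ?_, ?_, ?_⟩ <;> rw [hs] <;> try rw [Pi.single_eq_same]
  all_goals
    generalize a i = p at *
    generalize b i = q at *
    interval_cases p <;> interval_cases q <;> simp_all

/-- Points of `ℤ^N` at pairwise squared distance `2` are the endpoints of orthonormal
vectors at a common origin, apart from an exceptional configuration of four points. -/
theorem exists_origin {ι : Type*} [Fintype ι] (X : ι → Fin N → ℤ)
    (hX : ∀ i j, i ≠ j → dot (X i - X j) (X i - X j) = 2) (h3 : 3 ≤ Fintype.card ι)
    (h4 : Fintype.card ι ≠ 4 ∨ ∃ Y D, ∀ i, dot (Y - X i) (Y - X i) = D) :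
    ∃ O, Orthon fun i => X i - O := by
  classical
  obtain ⟨i1, i2, i3, h12, h13, h23⟩ := Fintype.two_lt_card_iff.1 h3
  have polar : ∀ i j : ι, i ≠ i1 → j ≠ i1 → i ≠ j → dot (X i - X i1) (X j - X i1) = 1 := by
    intro i j hi hj hij
    have e1 := hX i i1 hi
    have e2 := hX j i1 hj
    have e3 := hX i j hij
    simp only [dot_sub_left, dot_sub_right] at *
    linarith [dot_comm (X i) (X i1), dot_comm (X j) (X i1), dot_comm (X i) (X j)]
  set a := X i2 - X i1 with ha
  set b := X i3 - X i1 with hb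
  have haa : dot a a = 2 := hX _ _ h12.symm
  have hbb : dot b b = 2 := hX _ _ h13.symm
  have hab : dot a b = 1 := polar i2 i3 h12.symm h13.symm h23
  obtain ⟨c, hcc, hca, hcb⟩ := exists_common_unit haa hbb hab
  have hac := dot_comm a c
  have hbc := dot_comm b c
  have hon : Orthon ![c, a - c, b - c] := by
    apply orthon_three hcc <;> simp only [dot_sub_left, dot_sub_right] <;> linarith
  have gam : ∀ i, i ≠ i1 → i ≠ i2 → i ≠ i3 → dot (X i - X i1) c = 1 ∨
      (dot (X i - X i1) c = 0 ∧ X i - X i1 = (a - c) + (b - c)) := by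
    intro i hi1 hi2 hi3
    set d := X i - X i1
    have hda : dot d a = 1 := polar i i2 hi1 h12.symm hi2
    have hdb : dot d b = 1 := polar i i3 hi1 h13.symm hi3
    have hdd : dot d d = 2 := hX _ _ hi1
    have hB := hon.bessel Finset.univ d
    have hE := hon.eq_sum Finset.univ d
    simp only [Fin.sum_univ_three, Matrix.cons_val_zero, Matrix.cons_val_one,
      Matrix.cons_val, dot_sub_right, hda, hdb, hdd] at hB hE
    have g1 : dot d c ≤ 1 := by nlinarith
    have g2 : 0 ≤ dot d c := by nlinarith
    have g3 : dot d c = 0 ∨ dot d c = 1 := by omega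
    rcases g3 with g | g
    · right
      refine ⟨g, ?_⟩
      rw [g] at hE
      simpa using hE (by norm_num)
    · exact Or.inl g
  have hall : ∀ i, i ≠ i1 → dot (X i - X i1) c = 1 := by
    intro i hi1
    by_cases hi2 : i = i2
    · rw [hi2, ← ha, hac, hca]
    by_cases hi3 : i = i3
    · rw [hi3, ← hb, hbc, hcb]
    rcases gam i hi1 hi2 hi3 with h | ⟨-, hd⟩
    · exact h
    exfalso
    rcases h4 with h4 | ⟨Y, D, hY⟩
    · obtain ⟨j, hj⟩ : ∃ j, j ∉ ({i1, i2, i3, i} : Finset ι) := by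
        by_contra! hcon
        apply h4
        rw [← Finset.card_univ, ← Finset.eq_univ_iff_forall.2 hcon]
        rw [Finset.card_insert_of_notMem, Finset.card_insert_of_notMem,
          Finset.card_insert_of_notMem, Finset.card_singleton] <;>
          simp [*, Ne.symm hi1, Ne.symm hi2, Ne.symm hi3]
      simp only [Finset.mem_insert, Finset.mem_singleton, not_or] at hj
      obtain ⟨hj1, hj2, hj3, hji⟩ := hj
      rcases gam j hj1 hj2 hj3 with h | ⟨-, hd'⟩
      · have e1 := polar j i hj1 hi1 hji
        have e2 := polar j i2 hj1 h12.symm hj2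
        have e3 := polar j i3 hj1 h13.symm hj3
        rw [hd] at e1
        rw [← ha] at e2
        rw [← hb] at e3
        simp only [dot_add_right, dot_sub_right _ a c, dot_sub_right _ b c] at e1
        linarith
      · have := hX j i hji
        rw [← sub_sub_sub_cancel_right (X j) (X i) (X i1), hd, hd', sub_self, dot_zero_left] at this
        omega
    · have hy : ∀ j, j ≠ i1 → dot (Y - X i1) (X j - X i1) = 1 := by
        intro j hj
        have e1 := hX j i1 hj
        have e2 := hY j
        have e3 := hY i1
        simp only [dot_sub_left, dot_sub_right] at *
        linarith [dot_comm (X j) (X i1), dot_comm Y (X i1), dot_comm Y (X j)]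
      have e1 := hy i hi1
      have e2 := hy i2 h12.symm
      have e3 := hy i3 h13.symm
      rw [hd] at e1
      rw [← ha] at e2
      rw [← hb] at e3
      simp only [dot_add_right, dot_sub_right _ a c, dot_sub_right _ b c] at e1
      omega
  have hunit : ∀ i, dot (X i - (X i1 + c)) (X i - (X i1 + c)) = 1 := by
    intro i
    rw [← sub_sub]
    by_cases hi : i = i1
    · rw [hi, sub_self]
      rw [dot_sub_left, dot_sub_right, dot_zero_left, dot_zero_left, dot_sub_right,
        dot_comm c 0, dot_zero_left, hcc]
      norm_num
    · have e1 := hall i hi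
      have e2 := hX i i1 hi
      rw [dot_sub_left, dot_sub_right, dot_sub_right _ (X i - X i1) c, dot_comm c, e1, e2, hcc]
      norm_num
  refine ⟨X i1 + c, hunit, fun i j hij => ?_⟩
  have e1 := hunit i
  have e2 := hunit j
  have e3 := hX i j hij
  rw [← sub_sub_sub_cancel_right (X i) (X j) (X i1 + c)] at e3
  change dot (X i - (X i1 + c)) (X j - (X i1 + c)) = 0
  generalize X i - (X i1 + c) = p at *
  generalize X j - (X i1 + c) = q at *
  simp only [dot_sub_left, dot_sub_right] at e3
  linarith [dot_comm p q]

theorem exists_two_others {α : Type*} [Fintype α] (x : α) (hα : 3 ≤ Fintype.card α) :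
    ∃ y z : α, y ≠ x ∧ z ≠ x ∧ y ≠ z := by
  classical
  have : 1 < (Finset.univ.erase x).card := by
    rw [Finset.card_erase_of_mem (Finset.mem_univ x), Finset.card_univ]; omega
  obtain ⟨y, hy, z, hz, hyz⟩ := Finset.one_lt_card.1 this
  exact ⟨y, z, Finset.ne_of_mem_erase hy, Finset.ne_of_mem_erase hz, hyz⟩

/-- Orthonormal families with at least three members and mutually orthogonal differences
are mutually orthogonal. -/
theorem Orthon.cross {ι κ : Type*} [Fintype ι] [Fintype κ] {f : ι → Fin N → ℤ}
    {g : κ → Fin N → ℤ} (hf : Orthon f) (hg : Orthon g) (hι : 3 ≤ Fintype.card ι)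
    (hκ : 3 ≤ Fintype.card κ)
    (h : ∀ i j k l, dot (f i - f j) (g k - g l) = 0) (i : ι) (k : κ) :
    dot (f i) (g k) = 0 := by
  classical
  by_contra hne
  obtain ⟨j, -, hj, -, -⟩ := exists_two_others i hι
  obtain ⟨l, m, hl, hm, hlm⟩ := exists_two_others k hκ
  have row : ∀ p, ∀ q r, q ≠ r → dot (f p) (g q) ^ 2 + dot (f p) (g r) ^ 2 ≤ 1 := by
    intro p q r hqr
    have := hg.bessel {q, r} (f p)
    rwa [Finset.sum_pair hqr, hf.1] at this
  have col : dot (f i) (g k) ^ 2 + dot (f j) (g k) ^ 2 ≤ 1 := by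
    have := hf.bessel {i, j} (g k)
    rwa [Finset.sum_pair hj.symm, hg.1, dot_comm (g k), dot_comm (g k)] at this
  have hM : 1 ≤ dot (f i) (g k) ^ 2 := by
    have := sq_pos_of_ne_zero hne
    omega
  have zero : ∀ t : ℤ, dot (f i) (g k) ^ 2 + t ^ 2 ≤ 1 → t = 0 := by
    intro t ht
    have : t ^ 2 = 0 := by nlinarith [sq_nonneg t]
    exact pow_eq_zero_iff (two_ne_zero) |>.1 this
  have z1 := zero _ (row i k l hl.symm)
  have z2 := zero _ (row i k m hm.symm)
  have z3 := zero _ col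
  have e1 := h i j k l
  have e2 := h i j k m
  simp only [dot_sub_left, dot_sub_right] at e1 e2
  have y1 : dot (f j) (g l) = - dot (f i) (g k) := by linarith
  have y2 : dot (f j) (g m) = - dot (f i) (g k) := by linarith
  have := row j l m hlm
  rw [y1, y2] at this
  nlinarith

/-- Coordinates occupied by an orthonormal family can be discarded on its orthogonal
complement. -/
theorem Orthon.exists_projection {ι : Type*} [Fintype ι] {f : ι → Fin N → ℤ}
    (hf : Orthon f) : Fintype.card ι ≤ N ∧
      ∃ π : (Fin N → ℤ) →+ (Fin (N - Fintype.card ι) → ℤ),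
        ∀ u v, (∀ i, dot u (f i) = 0) → dot (π u) (π v) = dot u v := by
  classical
  have hax : ∀ i, ∃ k, ∀ u, dot u (f i) = 0 → u k = 0 := by
    intro i
    have h1 := hf.1 i
    obtain ⟨k, hk⟩ : ∃ k, f i k ≠ 0 := by
      by_contra! h
      simp [dot, h] at h1
    have hrest : ∀ l, l ≠ k → f i l = 0 := by
      intro l hl
      have hsum : f i k * f i k + f i l * f i l ≤ dot (f i) (f i) := by
        have := Finset.sum_le_sum_of_subset_of_nonneg (Finset.subset_univ {k, l})
          (f := fun x => f i x * f i x) (fun x _ _ => mul_self_nonneg (f i x))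
        rwa [Finset.sum_pair hl.symm] at this
      have : 0 < f i k * f i k := mul_self_pos.2 hk
      have h2 : f i l * f i l = 0 := by nlinarith [mul_self_nonneg (f i l)]
      simpa using h2
    refine ⟨k, fun u hu => ?_⟩
    rw [dot, Finset.sum_eq_single k (fun l _ hl => by rw [hrest l hl, mul_zero])
      (fun h => absurd (Finset.mem_univ k) h)] at hu
    exact (mul_eq_zero.1 hu).resolve_right hk
  choose ax hax using hax
  have hinj : Function.Injective ax := by
    intro i j hij
    by_contra hne
    have h1 : f i (ax j) = 0 := hax j _ (hf.2 i j hne)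
    rw [← hij] at h1
    have h2 : ∀ k, k ≠ ax i → f i k = 0 := by
      intro k hk
      have := hax i (Pi.single k (f i (ax i)) - Pi.single (ax i) (f i k)) (by
        simp [dot, sub_mul, Finset.sum_sub_distrib, Pi.single_apply]; ring)
      simpa [Pi.single_apply, hk.symm] using this
    have h3 := hf.1 i
    rw [dot, Finset.sum_eq_zero] at h3
    · omega
    · intro k _
      by_cases hk : k = ax i
      · rw [hk, h1, mul_zero]
      · rw [h2 k hk, mul_zero]
  have hcard : (Finset.univ.image ax).card = Fintype.card ι := by
    rw [Finset.card_image_of_injective _ hinj, Finset.card_univ]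
  refine ⟨?_, ?_⟩
  · have := Fintype.card_le_of_injective ax hinj
    simpa using this
  · let e : Fin (N - Fintype.card ι) ≃ {k // k ∈ (Finset.univ.image ax)ᶜ} :=
      (Finset.equivFinOfCardEq (by rw [Finset.card_compl, hcard, Fintype.card_fin])).symm
    refine ⟨{ toFun := fun u k => u (e k), map_zero' := rfl, map_add' := fun _ _ => rfl }, ?_⟩
    intro u v hu
    simp only [dot, AddMonoidHom.coe_mk, ZeroHom.coe_mk]
    rw [Equiv.sum_comp e (fun k => u k * v k), Finset.sum_coe_sort _ (fun k => u k * v k)]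
    refine Finset.sum_subset (Finset.subset_univ _) fun k _ hk => ?_
    simp only [Finset.mem_compl, Finset.mem_image, Finset.mem_univ, true_and, not_not] at hk
    obtain ⟨i, rfl⟩ := hk
    rw [hax i u (hu i), zero_mul]

end Dot

/-- The index of the component of a vertex. -/
def comp {P : List (List ℤ)} (v : (ofList P).V) : Fin P.length := Sigma.fst v

/-- The position of a vertex in its component. -/
def pos {P : List (List ℤ)} (v : (ofList P).V) : ℕ := (Sigma.snd v : Fin _)

theorem pos_lt {P : List (List ℤ)} (v : (ofList P).V) : pos v < (P.get (comp v)).length :=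
  (Sigma.snd v).2

theorem vertex_ext {P : List (List ℤ)} {u v : (ofList P).V} (h1 : comp u = comp v)
    (h2 : pos u = pos v) : u = v := by
  obtain ⟨i, j⟩ := u
  obtain ⟨i', j'⟩ := v
  obtain rfl : i = i' := h1
  obtain rfl : j = j' := Fin.ext h2
  rfl

/-- The vertex with a given component and position. -/
def mkV {P : List (List ℤ)} (i : Fin P.length) (j : ℕ) (h : j < (P.get i).length) :
    (ofList P).V := Sigma.mk i ⟨j, h⟩

@[simp] theorem comp_mkV {P : List (List ℤ)} (i : Fin P.length) (j : ℕ)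
    (h : j < (P.get i).length) : comp (mkV i j h) = i := rfl

@[simp] theorem pos_mkV {P : List (List ℤ)} (i : Fin P.length) (j : ℕ)
    (h : j < (P.get i).length) : pos (mkV i j h) = j := rfl

theorem w_eq {P : List (List ℤ)} (v : (ofList P).V) :
    (ofList P).w v = (P.get (comp v))[pos v]'(pos_lt v) := rfl

theorem adj_iff {P : List (List ℤ)} {u v : (ofList P).V} :
    (ofList P).graph.Adj u v ↔ comp u = comp v ∧ (pos u + 1 = pos v ∨ pos v + 1 = pos u) :=
  Iff.rfl

theorem deg_eq {P : List (List ℤ)} (v : (ofList P).V) :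
    (ofList P).deg v =
      (if 0 < pos v then 1 else 0) +
        (if pos v + 1 < (P.get (comp v)).length then 1 else 0) := by
  have hv := pos_lt v
  have key : (ofList P).graph.neighborSet v =
      {u | comp u = comp v ∧ pos u + 1 = pos v} ∪ {u | comp u = comp v ∧ pos v + 1 = pos u} := by
    ext u
    simp only [SimpleGraph.mem_neighborSet, adj_iff, Set.mem_union, Set.mem_ofPred_eq]
    constructor
    · rintro ⟨h, h' | h'⟩
      · exact Or.inr ⟨h.symm, h'⟩
      · exact Or.inl ⟨h.symm, h'⟩
    · rintro (⟨h, h'⟩ | ⟨h, h'⟩)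
      · exact ⟨h.symm, Or.inr h'⟩
      · exact ⟨h.symm, Or.inl h'⟩
  have h1 : {u : (ofList P).V | comp u = comp v ∧ pos u + 1 = pos v}.ncard =
      if 0 < pos v then 1 else 0 := by
    split_ifs with h
    · rw [Set.ncard_eq_one]
      refine ⟨mkV (comp v) (pos v - 1) (by omega), ?_⟩
      ext u
      simp only [Set.mem_ofPred_eq, Set.mem_singleton_iff]
      constructor
      · rintro ⟨hc, hp⟩
        exact vertex_ext hc (by rw [pos_mkV]; omega)
      · rintro rfl
        exact ⟨rfl, by rw [pos_mkV]; omega⟩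
    · rw [Set.ncard_eq_zero]
      ext u
      simp only [Set.mem_ofPred_eq, Set.mem_empty_iff_false, iff_false, not_and]
      omega
  have h2 : {u : (ofList P).V | comp u = comp v ∧ pos v + 1 = pos u}.ncard =
      if pos v + 1 < (P.get (comp v)).length then 1 else 0 := by
    split_ifs with h
    · rw [Set.ncard_eq_one]
      refine ⟨mkV (comp v) (pos v + 1) h, ?_⟩
      ext u
      simp only [Set.mem_ofPred_eq, Set.mem_singleton_iff]
      constructor
      · rintro ⟨hc, hp⟩
        exact vertex_ext hc (by rw [pos_mkV]; omega)
      · rintro rfl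
        exact ⟨rfl, by rw [pos_mkV]⟩
    · rw [Set.ncard_eq_zero]
      ext u
      simp only [Set.mem_ofPred_eq, Set.mem_empty_iff_false, iff_false, not_and]
      intro hc hp
      have := pos_lt u
      rw [hc] at this
      omega
  unfold Config.deg
  rw [key, Set.ncard_union_eq, h1, h2]
  rw [Set.disjoint_left]
  rintro u ⟨-, h⟩ ⟨-, h'⟩
  omega

/-- The slots of a configuration with dual `D`: every component has one slot more than its
dual has vertices. -/
abbrev Slots (D : List (List ℤ)) : Type := (i : Fin D.length) × Fin ((D.get i).length + 1)

theorem IsDualPair.w_le {P D : List (List ℤ)} (h : IsDualPair P D) (v : (ofList P).V) :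
    (ofList P).w v ≤ -2 := by
  obtain ⟨h0, h⟩ := h
  have := (h (comp v)).2.2.1 (-(ofList P).w v)
    (List.mem_map.2 ⟨_, List.getElem_mem (pos_lt v), rfl⟩)
  omega

/-- A distribution of the slots over the vertices, monotone along each component. -/
structure IsSlotMap (P D : List (List ℤ)) (ow : Slots D → (ofList P).V) : Prop where
  comp_val : ∀ s, (comp (ow s) : ℕ) = s.1
  step : ∀ (i : Fin D.length) (j : Fin (D.get i).length),
    (pos (ow ⟨i, j.succ⟩) : ℤ) = pos (ow ⟨i, j.castSucc⟩) + (D.get i).get j - 2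
  mono : ∀ i : Fin D.length, Monotone fun j => pos (ow ⟨i, j⟩)
  card : ∀ v, (Nat.card {s // ow s = v} : ℤ) = -(ofList P).w v - (ofList P).deg v

theorem IsSlotMap.comp_eq_iff {P D : List (List ℤ)} {ow : Slots D → (ofList P).V}
    (h : IsSlotMap P D ow) {s t : Slots D} : comp (ow s) = comp (ow t) ↔ s.1 = t.1 := by
  rw [Fin.ext_iff, Fin.ext_iff, h.comp_val, h.comp_val]

theorem IsDualPair.exists_slots {P D : List (List ℤ)} (h : IsDualPair P D) :
    ∃ ow : Slots D → (ofList P).V, IsSlotMap P D ow := by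
  obtain ⟨h0, h⟩ := h
  choose o ho0 hostep holast hocard using fun i => exists_slot_positions (h i)
  have hlt : ∀ (i : Fin P.length) (j : ℕ), j ≤ (D.get (Fin.cast h0 i)).length →
      o i j < (P.get i).length := by
    intro i j hj
    have hmono : ∀ d, j + d ≤ (D.get (Fin.cast h0 i)).length → o i j ≤ o i (j + d) := by
      intro d
      induction d with
      | zero => intro _; exact le_rfl
      | succ d ih =>
        intro hd
        have h1 := ih (by omega)
        have h2 := hostep i (j + d) (by omega)
        have h3 := (h i).2.2.2.1 _ (List.getElem_mem (show j + d < _ by omega))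
        rw [show j + (d + 1) = j + d + 1 by omega]
        omega
    have h1 := hmono ((D.get (Fin.cast h0 i)).length - j) (by omega)
    rw [show j + ((D.get (Fin.cast h0 i)).length - j) = (D.get (Fin.cast h0 i)).length by
      omega] at h1
    have h2 := holast i
    rw [List.length_map] at h2
    omega
  refine ⟨fun s => mkV (Fin.cast h0.symm s.1) (o (Fin.cast h0.symm s.1) s.2)
    (hlt _ _ (Nat.lt_succ_iff.1 s.2.2)), fun s => rfl, fun i j => ?_,
    fun i => Fin.monotone_iff_le_succ.2 fun j => ?_, fun v => ?_⟩
  · exact hostep (Fin.cast h0.symm i) j j.2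
  · have h2 := hostep (Fin.cast h0.symm i) j j.2
    have h3 : 2 ≤ (D.get (Fin.cast h0 (Fin.cast h0.symm i)))[(j : ℕ)]'j.2 :=
      (h (Fin.cast h0.symm i)).2.2.2.1 _ (List.getElem_mem j.2)
    have : o (Fin.cast h0.symm i) j ≤ o (Fin.cast h0.symm i) (j + 1) := by omega
    exact this
  · have hv : pos v < ((P.get (comp v)).map fun x => -x).length := by
      rw [List.length_map]; exact pos_lt v
    have := hocard (comp v) (pos v) hv
    rw [deg_eq, w_eq]
    simp only [List.getElem_map, List.length_map] at this
    have hcard : Nat.card {s : Slots D // mkV (Fin.cast h0.symm s.1)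
        (o (Fin.cast h0.symm s.1) s.2) (hlt _ _ (Nat.lt_succ_iff.1 s.2.2)) = v} =
        Nat.count (fun j => o (comp v) j = pos v)
          ((D.get (Fin.cast h0 (comp v))).length + 1) := by
      rw [Nat.count_eq_card_filter_range, ← Nat.card_eq_finsetCard]
      refine Nat.card_congr ⟨fun s => ⟨s.1.2, ?_⟩, fun j =>
        ⟨⟨Fin.cast h0 (comp v), ⟨j.1, ?_⟩⟩, ?_⟩, ?_, ?_⟩
      · obtain ⟨⟨i, j⟩, rfl⟩ := s
        exact Finset.mem_filter.2 ⟨Finset.mem_range.2 j.2, rfl⟩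
      · exact Finset.mem_range.1 (Finset.mem_filter.1 j.2).1
      · exact vertex_ext rfl (Finset.mem_filter.1 j.2).2
      · rintro ⟨⟨i, j⟩, rfl⟩
        rfl
      · intro j
        rfl
    rw [hcard, this]
    push_cast
    ring

/-- A placing of the slots of the configuration encoded by `P` in `ℤ^N`: every vertex `v`
owns `-w(v) - deg(v)` slots, and the distances between the points placed at the slots are
prescribed by the distances of their owners. -/
structure IsPlacing (P : List (List ℤ)) (N : ℕ) {S : Type} [Finite S] (own : S → (ofList P).V)
    (X : S → Fin N → ℤ) : Prop where
  card : ∀ v, (Nat.card {s // own s = v} : ℤ) = -(ofList P).w v - (ofList P).deg v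
  same : ∀ s t, s ≠ t → comp (own s) = comp (own t) →
    dot (X s - X t) (X s - X t) = 2 + |(pos (own s) : ℤ) - pos (own t)|
  orth : ∀ s s' t t', comp (own s) = comp (own s') → comp (own t) = comp (own t') →
    comp (own s) ≠ comp (own t) → dot (X s - X s') (X t - X t') = 0

theorem path_dot {n : ℕ} (a : ℕ → Fin N → ℤ)
    (hadj : ∀ j, j + 1 < n → dot (a j) (a (j + 1)) = -1)
    (hfar : ∀ j k, j + 1 < k → k < n → dot (a j) (a k) = 0) (j : ℕ) :
    ∀ k, j < k → k < n →
      dot (∑ t ∈ Finset.range k, a t - ∑ t ∈ Finset.range j, a t) (a k) = -1 := by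
  intro k hjk hk
  obtain ⟨k, rfl⟩ : ∃ l, k = l + 1 := ⟨k - 1, by omega⟩
  have hzero : ∀ l, l ≤ k → dot (∑ t ∈ Finset.range l, a t) (a (k + 1)) = 0 := by
    intro l hl
    rw [dot_sum_left]
    exact Finset.sum_eq_zero fun t ht =>
      hfar _ _ (by have := Finset.mem_range.1 ht; omega) hk
  rw [Finset.sum_range_succ, dot_sub_left, dot_add_left, hzero k le_rfl, hzero j (by omega),
    hadj k hk]
  norm_num

theorem path_dist {n : ℕ} (a : ℕ → Fin N → ℤ) (o : ℕ → ℤ)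
    (hself : ∀ j < n, dot (a j) (a j) = o (j + 1) - o j + 2)
    (hadj : ∀ j, j + 1 < n → dot (a j) (a (j + 1)) = -1)
    (hfar : ∀ j k, j + 1 < k → k < n → dot (a j) (a k) = 0) (j : ℕ) :
    ∀ k, j < k → k ≤ n →
      dot (∑ t ∈ Finset.range k, a t - ∑ t ∈ Finset.range j, a t)
        (∑ t ∈ Finset.range k, a t - ∑ t ∈ Finset.range j, a t) = 2 + (o k - o j) := by
  intro k
  induction k with
  | zero => intro h; omega
  | succ k ih =>
    intro hjk hk
    have hsplit : ∑ t ∈ Finset.range (k + 1), a t - ∑ t ∈ Finset.range j, a t =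
        (∑ t ∈ Finset.range k, a t - ∑ t ∈ Finset.range j, a t) + a k := by
      rw [Finset.sum_range_succ]; abel
    rw [hsplit, dot_add_left, dot_add_right, dot_add_right, hself k (by omega),
      dot_comm (a k) (_ - _)]
    rcases Nat.lt_or_ge j k with h | h
    · rw [ih h (by omega), path_dot a hadj hfar j k h (by omega)]
      ring
    · obtain rfl : j = k := by omega
      simp only [sub_self, dot_zero_left]
      ring

theorem IsSlotMap.exists_placing {P D : List (List ℤ)} {ow : Slots D → (ofList P).V}
    (h : IsSlotMap P D ow) {φ : (ofList D).V → Fin N → ℤ}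
    (hφ : (ofList D).IsEmbedding N φ) : ∃ X, IsPlacing P N ow X := by
  set a : Fin D.length → ℕ → Fin N → ℤ := fun i t =>
    if ht : t < (D.get i).length then φ (mkV i t ht) else 0 with ha
  have hav : ∀ i t (ht : t < (D.get i).length), a i t = φ (mkV i t ht) := fun i t ht => by
    simp only [ha, dif_pos ht]
  have hdiff : ∀ i i' t t', i ≠ i' → dot (a i t) (a i' t') = 0 := by
    intro i i' t t' hii
    simp only [ha]
    split_ifs with h1 h2
    · rw [hφ, if_neg, if_neg]
      · intro h; exact hii h.1
      · intro h; exact hii (congrArg comp h)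
    · rw [dot_comm, dot_zero_left]
    · exact dot_zero_left _
    · exact dot_zero_left _
  refine ⟨fun s => ∑ t ∈ Finset.range s.2, a s.1 t, h.card, ?_, ?_⟩
  · have key : ∀ i (j k : Fin ((D.get i).length + 1)), j < k →
        dot (∑ t ∈ Finset.range k, a i t - ∑ t ∈ Finset.range j, a i t)
          (∑ t ∈ Finset.range k, a i t - ∑ t ∈ Finset.range j, a i t) =
        2 + ((pos (ow ⟨i, k⟩) : ℤ) - pos (ow ⟨i, j⟩)) := by
      intro i j k hjk
      have := path_dist (n := (D.get i).length) (a i)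
        (fun t => if ht : t < (D.get i).length + 1 then (pos (ow ⟨i, ⟨t, ht⟩⟩) : ℤ) else 0)
        ?_ ?_ ?_ j k hjk (Nat.lt_succ_iff.1 k.2)
      · simpa only [dif_pos j.2, dif_pos k.2] using this
      · intro t ht
        rw [hav i t ht, hφ, if_pos rfl, dif_pos (by omega), dif_pos (by omega)]
        have := h.step i ⟨t, ht⟩
        simp only [Fin.succ_mk, Fin.castSucc_mk] at this
        rw [this, w_eq]
        simp only [comp_mkV, pos_mkV, List.get_eq_getElem]
        ring
      · intro t ht
        rw [hav i t (by omega), hav i (t + 1) ht, hφ, if_neg, if_pos]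
        · exact ⟨rfl, Or.inl rfl⟩
        · intro h; have := congrArg pos h; simp at this
      · intro t t' htt ht
        rw [hav i t (by omega), hav i t' ht, hφ, if_neg, if_neg]
        · rw [adj_iff]; simp; omega
        · intro h; have := congrArg pos h; simp at this; omega
    rintro ⟨i, j⟩ ⟨i', k⟩ hne hc
    obtain rfl : i = i' := h.comp_eq_iff.1 hc
    rcases lt_trichotomy j k with hjk | rfl | hjk
    · have h1 := key i j k hjk
      have h2 : pos (ow ⟨i, j⟩) ≤ pos (ow ⟨i, k⟩) := h.mono i hjk.le
      rw [abs_sub_comm, abs_of_nonneg (by omega), ← h1]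
      simp only [dot_sub_left, dot_sub_right]
      ring
    · exact absurd rfl hne
    · have h1 := key i k j hjk
      have h2 : pos (ow ⟨i, k⟩) ≤ pos (ow ⟨i, j⟩) := h.mono i hjk.le
      rw [abs_of_nonneg (by omega), ← h1]
  · have hz : ∀ s t : Slots D, s.1 ≠ t.1 →
        dot (∑ r ∈ Finset.range s.2, a s.1 r) (∑ r ∈ Finset.range t.2, a t.1 r) = 0 := by
      intro s t hst
      rw [dot_sum_left]
      refine Finset.sum_eq_zero fun r _ => ?_
      rw [dot_comm, dot_sum_left]
      exact Finset.sum_eq_zero fun r' _ => hdiff _ _ _ _ hst.symm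
    intro s s' t t' hs ht hne
    have e1 := h.comp_eq_iff.1 hs
    have e2 := h.comp_eq_iff.1 ht
    have e3 := fun he => hne (h.comp_eq_iff.2 he)
    rw [dot_sub_left, dot_sub_right, dot_sub_right, hz s t e3, hz s t' (e2 ▸ e3),
      hz s' t (e1 ▸ e3), hz s' t' (e1 ▸ e2 ▸ e3)]
    ring

theorem dot_polar (p q r s : Fin N → ℤ) :
    2 * dot (p - q) (r - s) =
      dot (p - s) (p - s) + dot (q - r) (q - r) - dot (p - r) (p - r) - dot (q - s) (q - s) := by
  simp only [dot_sub_left, dot_sub_right, dot_comm r p, dot_comm s p, dot_comm r q,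
    dot_comm s q]
  ring

theorem IsSlotMap.exists_embedding {P D : List (List ℤ)} {ow : Slots D → (ofList P).V}
    (h : IsSlotMap P D ow) {S : Type} [Finite S] {own : S → (ofList P).V} {X : S → Fin N → ℤ}
    (hX : IsPlacing P N own X) : ∃ φ, (ofList D).IsEmbedding N φ := by
  have hcard : ∀ v, Nat.card {s // ow s = v} = Nat.card {s // own s = v} := fun v => by
    have := h.card v
    rw [← hX.card v] at this
    exact_mod_cast this
  let e : Slots D ≃ S := Equiv.ofFiberEquiv fun v => (Finite.card_eq.1 (hcard v)).some
  have he : ∀ s, own (e s) = ow s := fun s => Equiv.ofFiberEquiv_map _ s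
  set Y : Slots D → Fin N → ℤ := fun s => X (e s) with hY
  have same : ∀ i (j k : Fin ((D.get i).length + 1)), j < k →
      dot (Y ⟨i, k⟩ - Y ⟨i, j⟩) (Y ⟨i, k⟩ - Y ⟨i, j⟩) =
        2 + ((pos (ow ⟨i, k⟩) : ℤ) - pos (ow ⟨i, j⟩)) := by
    intro i j k hjk
    have h2 : pos (ow ⟨i, j⟩) ≤ pos (ow ⟨i, k⟩) := h.mono i hjk.le
    rw [hX.same, he, he, abs_of_nonneg (by omega)]
    · intro hh
      have := e.injective hh
      simp at this
      omega
    · rw [he, he, h.comp_eq_iff]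
  refine ⟨fun v => Y ⟨comp v, (Sigma.snd v : Fin _).succ⟩ -
    Y ⟨comp v, (Sigma.snd v : Fin _).castSucc⟩, ?_⟩
  have hlt : ∀ i (j k : Fin (D.get i).length), j < k →
      dot (Y ⟨i, j.succ⟩ - Y ⟨i, j.castSucc⟩) (Y ⟨i, k.succ⟩ - Y ⟨i, k.castSucc⟩) =
        if (j : ℕ) + 1 = k then -1 else 0 := by
    intro i j k hjk
    have hjk' : (j : ℕ) < k := hjk
    have hp := dot_polar (Y ⟨i, k.succ⟩) (Y ⟨i, k.castSucc⟩) (Y ⟨i, j.succ⟩) (Y ⟨i, j.castSucc⟩)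
    rw [same i j.castSucc k.succ, same i j.castSucc k.castSucc, same i j.succ k.succ,
      dot_comm (_ - _) (Y ⟨i, j.succ⟩ - _)] at hp
    · split_ifs with hif
      · have : j.succ = k.castSucc := Fin.ext (by simpa using hif)
        rw [this, sub_self, dot_zero_left] at hp
        rw [this]
        linarith
      · rw [same i j.succ k.castSucc] at hp
        · linarith
        · rw [Fin.lt_def, Fin.val_succ, Fin.val_castSucc]; omega
    all_goals (rw [Fin.lt_def]; simp only [Fin.val_succ, Fin.val_castSucc]; omega)
  intro u v
  obtain ⟨i, j, rfl⟩ : ∃ i, ∃ j : Fin (D.get i).length, u = mkV i j j.2 := ⟨u.1, u.2, rfl⟩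
  obtain ⟨i', k, rfl⟩ : ∃ i, ∃ j : Fin (D.get i).length, v = mkV i j j.2 := ⟨v.1, v.2, rfl⟩
  change dot (Y ⟨i, j.succ⟩ - Y ⟨i, j.castSucc⟩) (Y ⟨i', k.succ⟩ - Y ⟨i', k.castSucc⟩) = _
  have hne : ∀ a b : Fin (D.get i).length, (a : ℕ) ≠ b → mkV i a a.2 ≠ mkV i b b.2 :=
    fun a b hab hh => hab (congrArg pos hh)
  by_cases hii : i = i'
  · subst hii
    rcases lt_trichotomy j k with hjk | rfl | hjk
    · have hjk' : (j : ℕ) < k := hjk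
      rw [hlt i j k hjk, if_neg (hne j k hjk'.ne)]
      refine if_congr ?_ rfl rfl
      rw [adj_iff]
      simp only [comp_mkV, pos_mkV, true_and]
      omega
    · rw [same _ _ _ Fin.castSucc_lt_succ, if_pos rfl, h.step, w_eq]
      simp only [comp_mkV, pos_mkV, List.get_eq_getElem]
      ring
    · have hjk' : (k : ℕ) < j := hjk
      rw [dot_comm, hlt i k j hjk, if_neg (hne j k hjk'.ne')]
      refine if_congr ?_ rfl rfl
      rw [adj_iff]
      simp only [comp_mkV, pos_mkV, true_and]
      omega
  · rw [if_neg (fun hh => hii (congrArg comp hh) : ¬ mkV i j j.2 = mkV i' k k.2),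
      if_neg (fun hh => hii hh.1 : ¬ (ofList D).graph.Adj (mkV i j j.2) (mkV i' k k.2))]
    refine hX.orth _ _ _ _ ?_ ?_ ?_ <;> simp only [he, ne_eq, h.comp_eq_iff]
    exact hii

theorem sum_deg {P : List (List ℤ)} (hP : ∀ i, P.get i ≠ []) :
    ∑ v, (ofList P).deg v + 2 * P.length = 2 * totalLen P := by
  have key : ∀ l : ℕ, ∑ j : Fin (l + 1), ((if 0 < (j : ℕ) then 1 else 0) +
      (if (j : ℕ) + 1 < l + 1 then 1 else 0)) = 2 * l := by
    intro l
    rw [Finset.sum_add_distrib, Fin.sum_univ_succ, Fin.sum_univ_castSucc (n := l)]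
    simp
    ring
  have h1 : ∑ v, (ofList P).deg v = ∑ i, ∑ j : Fin (P.get i).length,
      ((if 0 < (j : ℕ) then 1 else 0) + (if (j : ℕ) + 1 < (P.get i).length then 1 else 0)) := by
    exact (Finset.sum_congr rfl fun v _ => deg_eq v).trans (Fintype.sum_sigma _)
  have h2 : ∀ i : Fin P.length, ∑ j : Fin (P.get i).length,
      ((if 0 < (j : ℕ) then 1 else 0) + (if (j : ℕ) + 1 < (P.get i).length then 1 else 0)) + 2 =
      2 * (P.get i).length := by
    intro i
    obtain ⟨l, hl⟩ : ∃ l, (P.get i).length = l + 1 :=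
      ⟨_, (Nat.succ_pred_eq_of_pos (List.length_pos_iff.2 (hP i))).symm⟩
    rw [hl, key]
    ring
  have h3 : totalLen P = ∑ i : Fin P.length, (P.get i).length := by
    rw [totalLen, ← Fin.sum_univ_fun_getElem P List.length]
    rfl
  rw [h1, h3, Finset.mul_sum, ← Finset.sum_congr rfl fun i _ => h2 i, Finset.sum_add_distrib]
  simp [mul_comm]

theorem IsSlotMap.two_mul_totalLen {P D : List (List ℤ)} {ow : Slots D → (ofList P).V}
    (h : IsSlotMap P D ow) (hP : ∀ i, P.get i ≠ []) (hPD : P.length = D.length) :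
    2 * ((totalLen P + totalLen D : ℕ) : ℤ) =
      ∑ v, (-2 * (ofList P).w v - (ofList P).deg v) := by
  have h1 : (Fintype.card (Slots D) : ℤ) = ∑ v, (-(ofList P).w v - (ofList P).deg v) := by
    rw [← Finset.sum_congr rfl fun v _ => h.card v, ← Nat.cast_sum, ← Nat.card_eq_fintype_card,
      ← Nat.card_congr (Equiv.sigmaFiberEquiv ow), Nat.card_sigma]
  have h2 : Fintype.card (Slots D) = totalLen D + D.length := by
    rw [totalLen, ← Fin.sum_univ_fun_getElem D List.length]
    simp [Finset.sum_add_distrib]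
  have h3 := sum_deg hP
  rw [h2] at h1
  have h4 : ∑ v, (-2 * (ofList P).w v - ((ofList P).deg v : ℤ)) =
      2 * ∑ v, (-(ofList P).w v - (ofList P).deg v) + ∑ v, ((ofList P).deg v : ℤ) := by
    rw [Finset.mul_sum, ← Finset.sum_add_distrib]
    exact Finset.sum_congr rfl fun v _ => by ring
  rw [h4, ← h1, ← Nat.cast_sum]
  omega

/-- `f` identifies the configuration encoded by `P'` with the one obtained from the
configuration encoded by `P` by deleting `g`. -/
structure IsDeletion {P' P : List (List ℤ)} (f : (ofList P').V → (ofList P).V)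
    (g : (ofList P).V) : Prop where
  inj : Function.Injective f
  w : ∀ v, (ofList P).w (f v) = (ofList P').w v
  adj : ∀ u v, (ofList P').graph.Adj u v ↔ (ofList P).graph.Adj (f u) (f v)
  range : Set.range f = {g}ᶜ

namespace IsDeletion

variable {P' P : List (List ℤ)} {f : (ofList P').V → (ofList P).V} {g : (ofList P).V}

theorem ne (hf : IsDeletion f g) (v : (ofList P').V) : f v ≠ g := by
  have : f v ∈ ({g}ᶜ : Set (ofList P).V) := hf.range ▸ Set.mem_range_self v
  exact this

theorem exists_eq (hf : IsDeletion f g) {v : (ofList P).V} (hv : v ≠ g) : ∃ v', f v' = v := by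
  have : v ∈ Set.range f := hf.range ▸ hv
  exact this

theorem comp_and_pos (hf : IsDeletion f g) (i : Fin P'.length) :
    ∃ c : Fin P.length, ∃ p e : ℤ, ∀ j (hj : j < (P'.get i).length),
      comp (f (mkV i j hj)) = c ∧ (pos (f (mkV i j hj)) : ℤ) = p + e * j ∧
        (0 < j → e = 1 ∨ e = -1) := by
  by_cases h0 : 0 < (P'.get i).length
  · by_cases h1 : 1 < (P'.get i).length
    · have hadj : ∀ j (hj : j + 1 < (P'.get i).length), (ofList P).graph.Adj
          (f (mkV i j (by omega))) (f (mkV i (j + 1) hj)) := fun j hj =>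
        (hf.adj _ _).1 ⟨rfl, Or.inl rfl⟩
      refine ⟨comp (f (mkV i 0 h0)), pos (f (mkV i 0 h0)),
        pos (f (mkV i 1 h1)) - pos (f (mkV i 0 h0)), fun j => ?_⟩
      induction j using Nat.strong_induction_on with
      | _ j ih =>
        intro hj
        rcases j with - | - | j
        · simp
        · have := adj_iff.1 ((hf.adj (mkV i 0 h0) (mkV i 1 h1)).1 ⟨rfl, Or.inl rfl⟩)
          refine ⟨this.1.symm, by simp, fun _ => ?_⟩
          rcases this.2 with h | h <;> omega
        · obtain ⟨c1, p1, e1⟩ := ih (j + 1) (by omega) (by omega)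
          obtain ⟨c0, p0, -⟩ := ih j (by omega) (by omega)
          have := adj_iff.1 (hadj (j + 1) hj)
          have hne : pos (f (mkV i (j + 1 + 1) hj)) ≠ pos (f (mkV i j (by omega))) := by
            intro hh
            have := hf.inj (vertex_ext (by rw [← this.1, c1, c0]) hh)
            have := congrArg pos this
            simp only [pos_mkV] at this
            omega
          refine ⟨by rw [← this.1, c1], ?_, fun _ => e1 (by omega)⟩
          push_cast at p1 ⊢
          rcases e1 (by omega) with he | he <;> rw [he] at p1 p0 ⊢ <;>
            rcases this.2 with h | h <;> omega
    · refine ⟨comp (f (mkV i 0 h0)), pos (f (mkV i 0 h0)), 0, fun j hj => ?_⟩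
      obtain rfl : j = 0 := by omega
      simp
  · exact ⟨comp g, 0, 0, fun j hj => absurd hj (by omega)⟩

theorem comp_eq (hf : IsDeletion f g) {u v : (ofList P').V} (h : comp u = comp v) :
    comp (f u) = comp (f v) ∧
      |(pos (f u) : ℤ) - pos (f v)| = |(pos u : ℤ) - pos v| := by
  obtain ⟨i, j, hj, rfl⟩ : ∃ i, ∃ j, ∃ hj, u = mkV i j hj := ⟨u.1, u.2, u.2.2, rfl⟩
  obtain ⟨i', k, hk, rfl⟩ : ∃ i, ∃ j, ∃ hj, v = mkV i j hj := ⟨v.1, v.2, v.2.2, rfl⟩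
  obtain rfl : i = i' := h
  obtain ⟨c, p, e, H⟩ := hf.comp_and_pos i
  obtain ⟨cj, pj, ej⟩ := H j hj
  obtain ⟨ck, pk, ek⟩ := H k hk
  refine ⟨by rw [cj, ck], ?_⟩
  rw [pj, pk, pos_mkV, pos_mkV]
  rcases Nat.eq_zero_or_pos j with rfl | hj0
  · rcases Nat.eq_zero_or_pos k with rfl | hk0
    · simp
    · rcases ek hk0 with rfl | rfl
      · congr 1; ring
      · rw [← abs_neg]; congr 1; ring
  · rcases ej hj0 with rfl | rfl
    · congr 1; ring
    · rw [← abs_neg]; congr 1; ring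

theorem comp_eq_of_not_between (hf : IsDeletion f g) (d : ℕ) :
    ∀ u v : (ofList P').V, comp (f u) = comp (f v) → pos (f u) + d = pos (f v) →
      (comp g = comp (f u) → pos g < pos (f u) ∨ pos (f v) < pos g) → comp u = comp v := by
  induction d with
  | zero =>
    intro u v hc hp _
    rw [hf.inj (vertex_ext hc hp)]
  | succ d ih =>
    intro u v hc hp hg
    have hlt : pos (f u) + 1 < (P.get (comp (f u))).length := by
      have := pos_lt (f v)
      rw [← hc] at this
      omega
    obtain ⟨x, hx⟩ := hf.exists_eq (v := mkV (comp (f u)) (pos (f u) + 1) hlt) (by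
      rintro rfl
      have := hg rfl
      rw [pos_mkV] at this
      omega)
    have hux : comp u = comp x := by
      have : (ofList P').graph.Adj u x := (hf.adj _ _).2 (by rw [hx]; exact ⟨rfl, Or.inl rfl⟩)
      exact this.1
    rw [hux]
    refine ih x v (by rw [hx, comp_mkV, hc]) (by rw [hx, pos_mkV]; omega) fun h => ?_
    rw [hx, comp_mkV] at h
    rw [hx, pos_mkV]
    have hne : pos g ≠ pos (f u) := fun hh => hf.ne u (vertex_ext h.symm hh.symm)
    have hne' : pos g ≠ pos (f u) + 1 := fun hh => hf.ne x (by
      rw [hx]; exact vertex_ext h.symm hh.symm)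
    have := hg h
    omega

theorem between_of_comp_ne (hf : IsDeletion f g) {u v : (ofList P').V}
    (hc : comp (f u) = comp (f v)) (hne : comp u ≠ comp v) :
    comp (f u) = comp g ∧ ((pos (f u) < pos g ∧ pos g < pos (f v)) ∨
      (pos (f v) < pos g ∧ pos g < pos (f u))) := by
  have h1 : ∀ x y : (ofList P').V, comp (f x) = comp (f y) → comp x ≠ comp y →
      pos (f x) ≤ pos (f y) →
      comp (f x) = comp g ∧ (pos (f x) < pos g ∧ pos g < pos (f y)) := by
    intro x y hxy hxy' hp
    by_contra hcon
    refine hxy' (hf.comp_eq_of_not_between (pos (f y) - pos (f x)) x y hxy (by omega) fun h => ?_)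
    have hx : pos (f x) ≠ pos g := fun hh => hf.ne x (vertex_ext h.symm hh)
    have hy : pos (f y) ≠ pos g := fun hh => hf.ne y (vertex_ext (by rw [← hxy, h]) hh)
    have := fun h' => hcon ⟨h.symm, h'⟩
    omega
  rcases le_total (pos (f u)) (pos (f v)) with h | h
  · obtain ⟨h2, h3⟩ := h1 u v hc hne h
    exact ⟨h2, Or.inl h3⟩
  · obtain ⟨h2, h3⟩ := h1 v u hc.symm hne.symm h
    exact ⟨by rw [hc, h2], Or.inr h3⟩

theorem not_between (hf : IsDeletion f g) {u v : (ofList P').V} (hc : comp u = comp v)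
    (hg : comp (f u) = comp g) : ¬ (pos (f u) < pos g ∧ pos g < pos (f v)) := by
  rintro ⟨h1, h2⟩
  obtain ⟨i, j, hj, rfl⟩ : ∃ i, ∃ j, ∃ hj, u = mkV i j hj := ⟨u.1, u.2, u.2.2, rfl⟩
  obtain ⟨i', k, hk, rfl⟩ : ∃ i, ∃ j, ∃ hj, v = mkV i j hj := ⟨v.1, v.2, v.2.2, rfl⟩
  obtain rfl : i = i' := hc
  obtain ⟨c, p, e, H⟩ := hf.comp_and_pos i
  obtain ⟨cj, pj, ej⟩ := H j hj
  obtain ⟨ck, pk, ek⟩ := H k hk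
  obtain ⟨l, hl, hl'⟩ : ∃ l, l < (P'.get i).length ∧ (pos g : ℤ) = p + e * l := by
    have hjk : 0 < j ∨ 0 < k := by
      by_contra hh
      obtain rfl : j = 0 := by omega
      obtain rfl : k = 0 := by omega
      omega
    have he : e = 1 ∨ e = -1 := hjk.elim ej ek
    rcases he with rfl | rfl
    · exact ⟨j + (pos g - pos (f (mkV i j hj))), by omega, by push_cast; omega⟩
    · exact ⟨j - (pos g - pos (f (mkV i j hj))), by omega, by omega⟩
  obtain ⟨cl, pl, -⟩ := H l hl
  exact hf.ne (mkV i l hl) (vertex_ext (by rw [cl, ← hg, cj]) (by omega))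

theorem deg_eq_add (hf : IsDeletion f g) (v : (ofList P').V) :
    (ofList P).deg (f v) =
      (ofList P').deg v + if (ofList P).graph.Adj g (f v) then 1 else 0 := by
  have h1 : (f '' (ofList P').graph.neighborSet v).ncard = (ofList P').deg v :=
    Set.ncard_image_of_injective _ hf.inj
  have h2 : (ofList P).graph.neighborSet (f v) =
      f '' (ofList P').graph.neighborSet v ∪ {x | x = g ∧ (ofList P).graph.Adj g (f v)} := by
    ext x
    simp only [SimpleGraph.mem_neighborSet, Set.mem_union, Set.mem_image, Set.mem_ofPred_eq]
    constructor
    · intro h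
      rcases eq_or_ne x g with rfl | hx
      · exact Or.inr ⟨rfl, h.symm⟩
      · obtain ⟨y, rfl⟩ := hf.exists_eq hx
        exact Or.inl ⟨y, (hf.adj _ _).2 h, rfl⟩
    · rintro (⟨y, hy, rfl⟩ | ⟨rfl, h⟩)
      · exact (hf.adj _ _).1 hy
      · exact h.symm
  unfold Config.deg at h1 ⊢
  rw [h2, Set.ncard_union_eq, h1]
  · congr 1
    split_ifs with h
    · simp [h]
    · simp [h]
  · rw [Set.disjoint_left]
    rintro _ ⟨y, -, rfl⟩ ⟨h, -⟩
    exact hf.ne y h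

theorem sum_eq (hf : IsDeletion f g) :
    ∑ v, (-2 * (ofList P').w v - ((ofList P').deg v : ℤ)) =
      ∑ v, (-2 * (ofList P).w v - ((ofList P).deg v : ℤ)) -
        2 * (-(ofList P).w g - (ofList P).deg g) := by
  classical
  have hrange : Finset.univ.erase g = Finset.univ.map ⟨f, hf.inj⟩ := by
    ext v
    simp only [Finset.mem_erase, Finset.mem_univ, and_true, Finset.mem_map, true_and,
      Function.Embedding.coeFn_mk]
    exact ⟨fun h => hf.exists_eq h, fun ⟨x, hx⟩ => hx ▸ hf.ne x⟩
  have hsum : ∀ F : (ofList P).V → ℤ, ∑ v, F v = F g + ∑ v, F (f v) := by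
    intro F
    rw [← Finset.add_sum_erase _ F (Finset.mem_univ g), hrange, Finset.sum_map]
    rfl
  have hdeg : ((ofList P).deg g : ℤ) = ∑ v, if (ofList P).graph.Adj g v then 1 else 0 := by
    rw [Config.deg, Finset.sum_boole, Set.ncard_eq_toFinset_card']
    congr 2
    ext v
    simp
  rw [hsum] at hdeg ⊢
  have h1 : ∑ v, (-2 * (ofList P).w (f v) - ((ofList P).deg (f v) : ℤ)) =
      ∑ v, (-2 * (ofList P').w v - ((ofList P').deg v : ℤ)) -
        ∑ v, (if (ofList P).graph.Adj g (f v) then 1 else 0 : ℤ) := by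
    rw [← Finset.sum_sub_distrib]
    refine Finset.sum_congr rfl fun v _ => ?_
    rw [hf.w, hf.deg_eq_add]
    push_cast
    ring
  rw [h1, ← sub_eq_iff_eq_add'.2 hdeg]
  simp
  ring

end IsDeletion

/-- The points owned by `g` minus `O` form an orthonormal family which is orthogonal to all
the differences of points that survive the deletion of `g`. -/
structure IsRemovable {P : List (List ℤ)} {S : Type} (own : S → (ofList P).V)
    (X : S → Fin N → ℤ) (g : (ofList P).V) (O : Fin N → ℤ) : Prop where
  orthon : Orthon fun t : {t // own t = g} => X t - O
  same : ∀ s, own s ≠ g → comp (own s) = comp g → ∀ t, own t = g →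
    dot (X s - O) (X t - O) = 0
  other : ∀ s s', comp (own s) = comp (own s') → comp (own s) ≠ comp g → ∀ t, own t = g →
    dot (X s - X s') (X t - O) = 0

theorem IsPlacing.dist_origin {P : List (List ℤ)} {S : Type} [Finite S]
    {own : S → (ofList P).V} {X : S → Fin N → ℤ} (hX : IsPlacing P N own X) {g : (ofList P).V}
    {O : Fin N → ℤ} {t : S} (ht : own t = g) (hunit : dot (X t - O) (X t - O) = 1) {s : S}
    (hs : own s ≠ g) (hc : comp (own s) = comp g) :
    dot (X s - O) (X s - O) =
      1 + |(pos (own s) : ℤ) - pos g| + 2 * dot (X s - O) (X t - O) := by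
  have h1 := hX.same s t (fun h => hs (h ▸ ht)) (by rw [hc, ht])
  have h2 : X s - X t = (X s - O) - (X t - O) := by abel
  rw [h2, dot_sub_self, hunit, ht] at h1
  linarith

theorem IsPlacing.delete {P P' : List (List ℤ)} {S : Type} [Finite S] {own : S → (ofList P).V}
    {X : S → Fin N → ℤ} (hX : IsPlacing P N own X) {g : (ofList P).V} {O : Fin N → ℤ}
    (hne : ∃ t, own t = g) (hO : IsRemovable own X g O) {f : (ofList P').V → (ofList P).V}
    (hf : IsDeletion f g) :
    Nat.card {t // own t = g} ≤ N ∧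
      ∃ (own' : {s // own s ≠ g} ⊕ {v // (ofList P).graph.Adj g (f v)} → (ofList P').V)
        (X' : _ → Fin (N - Nat.card {t // own t = g}) → ℤ),
        IsPlacing P' (N - Nat.card {t // own t = g}) own' X' := by
  classical
  have := Fintype.ofFinite S
  obtain ⟨t₀, ht₀⟩ := hne
  rw [Nat.card_eq_fintype_card]
  obtain ⟨hle, π, hπ⟩ := hO.orthon.exists_projection
  refine ⟨hle, ?_⟩
  choose fi hfi using fun v (hv : v ≠ g) => hf.exists_eq hv
  set own' : {s // own s ≠ g} ⊕ {v // (ofList P).graph.Adj g (f v)} → (ofList P').V :=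
    Sum.elim (fun s => fi (own s) s.2) (fun v => v) with hown'
  set Z : {s // own s ≠ g} ⊕ {v // (ofList P).graph.Adj g (f v)} → Fin N → ℤ :=
    Sum.elim (fun s => X s) (fun _ => O) with hZ
  have hunit : dot (X t₀ - O) (X t₀ - O) = 1 := hO.orthon.1 ⟨t₀, ht₀⟩
  have hl : ∀ s : {s // own s ≠ g}, f (own' (Sum.inl s)) = own s := fun s => hfi _ s.2
  have hr : ∀ v : {v // (ofList P).graph.Adj g (f v)}, f (own' (Sum.inr v)) = f v := fun v => rfl
  have hperpO : ∀ s, comp (f (own' s)) = comp g → ∀ t, own t = g →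
      dot (Z s - O) (X t - O) = 0 := by
    rintro (s | v) hs t ht
    · exact hO.same s s.2 (by rw [← hl, hs]) t ht
    · change dot (O - O) _ = 0
      rw [sub_self, dot_zero_left]
  have hinl : ∀ s, comp (f (own' s)) ≠ comp g → ∃ s', s = Sum.inl s' := by
    rintro (s | v) hs
    · exact ⟨s, rfl⟩
    · exact absurd v.2.1.symm hs
  have hperp : ∀ s s', comp (f (own' s)) = comp (f (own' s')) → ∀ t, own t = g →
      dot (Z s - Z s') (X t - O) = 0 := by
    intro s s' hss t ht
    by_cases hc : comp (f (own' s)) = comp g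
    · have h1 := hperpO s hc t ht
      have h2 := hperpO s' (hss ▸ hc) t ht
      rw [← sub_sub_sub_cancel_right (Z s) (Z s') O, dot_sub_left, h1, h2, sub_zero]
    · obtain ⟨s, rfl⟩ := hinl s hc
      obtain ⟨s', rfl⟩ := hinl s' (hss ▸ hc)
      refine hO.other s s' ?_ ?_ t ht
      · rw [← hl, ← hl, hss]
      · rw [← hl]; exact hc
  have hπ' : ∀ s s' t t', comp (f (own' s)) = comp (f (own' s')) →
      dot (π (Z s) - π (Z s')) (π (Z t) - π (Z t')) = dot (Z s - Z s') (Z t - Z t') := by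
    intro s s' t t' h
    rw [← map_sub, ← map_sub]
    exact hπ _ _ fun i => hperp s s' h i i.2
  have hnorm : ∀ s : {s // own s ≠ g}, comp (own s) = comp g →
      dot (X s - O) (X s - O) = 1 + |(pos (own s) : ℤ) - pos g| := by
    intro s hs
    rw [hX.dist_origin ht₀ hunit s.2 hs, hO.same s s.2 hs t₀ ht₀]
    ring
  refine ⟨own', fun s => π (Z s), ?_, ?_, ?_⟩
  · intro v
    have e1 : Nat.card {s // own' s = v} = Nat.card {s // own s = f v} +
        if (ofList P).graph.Adj g (f v) then 1 else 0 := by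
      rw [Nat.card_congr Equiv.subtypeSum, Nat.card_sum]
      congr 1
      · refine Nat.card_congr ⟨fun s => ⟨s.1.1, ?_⟩, fun s => ⟨⟨s.1, ?_⟩, ?_⟩, ?_, ?_⟩
        · rw [← hl, s.2]
        · rw [s.2]; exact hf.ne v
        · refine hf.inj ?_
          rw [hl]; exact s.2
        · rintro ⟨⟨s, hs⟩, hs'⟩; rfl
        · rintro ⟨s, hs⟩; rfl
      · split_ifs with h
        · rw [Nat.card_eq_one_iff_unique]
          refine ⟨⟨?_⟩, ⟨⟨⟨v, h⟩, rfl⟩⟩⟩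
          rintro ⟨⟨a, ha⟩, rfl⟩ ⟨⟨b, hb⟩, hb'⟩
          exact Subtype.ext (Subtype.ext hb'.symm)
        · rw [Nat.card_eq_zero]
          left
          constructor
          rintro ⟨⟨a, ha⟩, rfl⟩
          exact h ha
    have e2 := hX.card (f v)
    rw [hf.w, hf.deg_eq_add] at e2
    rw [e1]
    push_cast at e2 ⊢
    linarith
  · intro s t hst hc
    obtain ⟨hc', hp'⟩ := hf.comp_eq hc
    rw [hπ' s t s t hc', ← hp']
    have mixed : ∀ (s : {s // own s ≠ g}) (v : {v // (ofList P).graph.Adj g (f v)}),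
        comp (own' (Sum.inl s)) = comp (own' (Sum.inr v)) →
        dot (X s - O) (X s - O) = 2 + |(pos (own s) : ℤ) - pos (f v)| := by
      intro s v h
      have h1 := (hf.comp_eq h).1
      rw [hl, hr] at h1
      have hv := v.2
      have hvc : comp g = comp (f v) := hv.1
      have h2 : ¬ _ := hf.not_between h (by rw [hl, h1, ← hvc])
      have h3 : ¬ _ := hf.not_between h.symm (by rw [hr, ← hvc])
      have hs : pos (own s) ≠ pos g := fun hh => s.2 (vertex_ext (by rw [h1, hvc]) hh)
      rw [hl, hr] at h2 h3
      rw [hnorm s (by rw [h1, hvc])]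
      have hv2 : pos g + 1 = pos (f v) ∨ pos (f v) + 1 = pos g := hv.2
      rcases hv2 with hv2 | hv2
      · rw [abs_of_nonneg (by omega), abs_of_nonneg (by omega)]; omega
      · rw [abs_of_nonpos (by omega), abs_of_nonpos (by omega)]; omega
    rcases s with s | v <;> rcases t with t | u
    · rw [hl, hl] at hc' ⊢
      exact hX.same s t (fun h => hst (congrArg Sum.inl (Subtype.ext h))) hc'
    · rw [hl, hr]
      exact mixed s u hc
    · rw [hl, hr, abs_sub_comm]
      rw [← mixed t v hc.symm]
      change dot (O - X t) (O - X t) = _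
      simp only [dot_sub_left, dot_sub_right]
      ring
    · exfalso
      have hne : pos (f v) ≠ pos (f u) := fun hh =>
        hst (congrArg Sum.inr (Subtype.ext (hf.inj (vertex_ext hc' hh))))
      have h2 : ¬ _ := hf.not_between hc v.2.1.symm
      have h3 : ¬ _ := hf.not_between hc.symm u.2.1.symm
      rw [hr, hr] at h2 h3
      have hv : pos g + 1 = pos (f v) ∨ pos (f v) + 1 = pos g := v.2.2
      have hu : pos g + 1 = pos (f u) ∨ pos (f u) + 1 = pos g := u.2.2
      omega
  · intro s s' t t' hs ht hne
    have hs' := (hf.comp_eq hs).1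
    have ht' := (hf.comp_eq ht).1
    change dot (π (Z s) - π (Z s')) (π (Z t) - π (Z t')) = 0
    rw [hπ' s s' t t' hs']
    have hcross : ∀ s, comp (f (own' s)) = comp g → ∀ t t',
        comp (f (own' t)) = comp (f (own' t')) → comp (f (own' t)) ≠ comp g →
        dot (Z s - O) (Z t - Z t') = 0 := by
      intro s hs t t' htt ht
      have hp := hperp t t' htt t₀ ht₀
      obtain ⟨t, rfl⟩ := hinl t ht
      obtain ⟨t', rfl⟩ := hinl t' (htt ▸ ht)
      rcases s with s | v
      · have e : Z (Sum.inl s) - O = (X s - X t₀) + (X t₀ - O) := by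
          change X s - O = _
          abel
        rw [hl] at hs ht
        rw [hl, hl] at htt
        rw [e, dot_add_left, dot_comm (X t₀ - O), hp, add_zero]
        exact hX.orth s t₀ t t' (by rw [hs, ht₀]) htt (by rw [hs]; exact ht.symm)
      · change dot (O - O) _ = 0
        rw [sub_self, dot_zero_left]
    have hopp : ∀ s t, comp (f (own' s)) = comp (f (own' t)) → comp (own' s) ≠ comp (own' t) →
        dot (Z s - O) (Z t - O) = 0 := by
      intro s t hc hcne
      obtain ⟨hg, hbet⟩ := hf.between_of_comp_ne hc hcne
      rcases s with s | v
      · rcases t with t | u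
        · rw [hl, hl] at hc hbet
          rw [hl] at hg
          have hst : s.1 ≠ t.1 := fun hh => by rw [hh] at hbet; omega
          have h1 := hX.same s t hst hc
          have h2 := hnorm s hg
          have h3 := hnorm t (hc ▸ hg)
          have h4 : X s - X t = (X s - O) - (X t - O) := by abel
          rw [h4, dot_sub_self, h2, h3] at h1
          change dot (X s - O) (X t - O) = 0
          rcases hbet with hb | hb
          · rw [abs_of_nonpos (by omega), abs_of_nonneg (by omega),
              abs_of_nonpos (by omega)] at h1
            omega
          · rw [abs_of_nonneg (by omega), abs_of_nonpos (by omega),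
              abs_of_nonneg (by omega)] at h1
            omega
        · rw [dot_comm]
          change dot (O - O) _ = 0
          rw [sub_self, dot_zero_left]
      · change dot (O - O) _ = 0
        rw [sub_self, dot_zero_left]
    by_cases hc : comp (f (own' s)) = comp (f (own' t))
    · rw [← sub_sub_sub_cancel_right (Z s) (Z s') O, ← sub_sub_sub_cancel_right (Z t) (Z t') O,
        dot_sub_left, dot_sub_right _ (Z t - O), dot_sub_right _ (Z t - O), hopp s t hc hne,
        hopp s t' (by rw [hc, ht']) (by rw [← ht]; exact hne),
        hopp s' t (by rw [← hs', hc]) (by rw [← hs]; exact hne),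
        hopp s' t' (by rw [← hs', hc, ht']) (by rw [← hs, ← ht]; exact hne)]
      ring
    · by_cases hsg : comp (f (own' s)) = comp g
      · have htg : comp (f (own' t)) ≠ comp g := fun h => hc (hsg.trans h.symm)
        rw [← sub_sub_sub_cancel_right (Z s) (Z s') O, dot_sub_left,
          hcross s hsg t t' ht' htg, hcross s' (hs' ▸ hsg) t t' ht' htg, sub_zero]
      · by_cases htg : comp (f (own' t)) = comp g
        · rw [dot_comm, ← sub_sub_sub_cancel_right (Z t) (Z t') O, dot_sub_left,
            hcross t htg s s' hs' hsg, hcross t' (ht' ▸ htg) s s' hs' hsg, sub_zero]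
        · obtain ⟨a, rfl⟩ := hinl s hsg
          obtain ⟨a', rfl⟩ := hinl s' (hs' ▸ hsg)
          obtain ⟨b, rfl⟩ := hinl t htg
          obtain ⟨b', rfl⟩ := hinl t' (ht' ▸ htg)
          rw [hl, hl] at hs' ht' hc
          exact hX.orth a a' b b' hs' ht' hc

theorem failsX_of_isRemovable {k : ℕ} {P D P' D' : List (List ℤ)} (h : IsDualPair P D)
    (h' : IsDualPair P' D') {ow : Slots D → (ofList P).V} (how : IsSlotMap P D ow)
    {X : Slots D → Fin (totalLen P + totalLen D - k) → ℤ}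
    (hk : k ≤ totalLen P + totalLen D) (hX : IsPlacing P _ ow X) {g : (ofList P).V}
    {O : Fin (totalLen P + totalLen D - k) → ℤ}
    (hne : ∃ t, ow t = g) (hO : IsRemovable ow X g O) {f : (ofList P').V → (ofList P).V}
    (hf : IsDeletion f g) : FailsX k P' D' := by
  have hnil : ∀ {P D : List (List ℤ)}, IsDualPair P D → ∀ i, P.get i ≠ [] := by
    rintro P D ⟨h0, h⟩ i hi
    exact (h i).1 (by rw [hi]; rfl)
  obtain ⟨ow', how'⟩ := h'.exists_slots
  obtain ⟨hle, own', X', hX'⟩ := hX.delete hne hO hf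
  have e1 := how.two_mul_totalLen (hnil h) h.1
  have e2 := how'.two_mul_totalLen (hnil h') h'.1
  have e3 := hX.card g
  rw [hf.sum_eq, ← e1, ← e3] at e2
  have e4 : totalLen P' + totalLen D' - k =
      totalLen P + totalLen D - k - Nat.card {t // ow t = g} := by omega
  refine ⟨by omega, ?_⟩
  rw [e4]
  exact how'.exists_embedding hX'

/-- Vectors at signed positions `e s ≠ 0` on a line, seen from an origin at position `0` carrying
`m` orthonormal vectors with sum `F`, with which each `V s` has inner product `κ s`. -/
structure IsLineup {S : Type*} (m : ℤ) (F : Fin N → ℤ) (V : S → Fin N → ℤ) (e κ : S → ℤ) :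
    Prop where
  sum : dot F F = m
  left : ∀ s, dot F (V s) = m * κ s
  self : ∀ s, dot (V s) (V s) = 1 + |e s| + 2 * κ s
  pair : ∀ s t, s ≠ t → 2 * dot (V s) (V t) = |e s| + |e t| - |e s - e t| + 2 * κ s + 2 * κ t

namespace IsLineup

variable {S : Type*} {m : ℤ} {F : Fin N → ℤ} {V : S → Fin N → ℤ} {e κ : S → ℤ}

theorem right (h : IsLineup m F V e κ) (s : S) : dot (V s) F = m * κ s := by
  rw [dot_comm, h.left]

theorem bessel (h : IsLineup m F V e κ) (s : S) : m * κ s ^ 2 ≤ 1 + |e s| + 2 * κ s := by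
  have := dot_self_nonneg (V s - κ s • F)
  simp only [dot_sub_left, dot_sub_right, dot_smul_left, dot_smul_right, h.sum, h.left, h.right,
    h.self] at this
  linarith

theorem coeff_eq (h : IsLineup m F V e κ) (hm : 3 ≤ m) {s : S} (hs : |e s| = 1) :
    κ s = 0 ∨ κ s = 1 ∧ m ≤ 4 := by
  have h1 := h.bessel s
  rw [hs] at h1
  have h2 : κ s < 2 := by nlinarith [sq_nonneg (κ s)]
  have h3 : -1 < κ s := by nlinarith [sq_nonneg (κ s)]
  have h4 : κ s = 0 ∨ κ s = 1 := by omega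
  rcases h4 with h4 | h4
  · exact Or.inl h4
  · rw [h4] at h1
    exact Or.inr ⟨h4, by linarith⟩

/-- Beyond a vector at position `ε = ±1` there is a second vector at position `ε`, or there are
two vectors at position `2 ε`. -/
def Beyond (e : S → ℤ) (ε : ℤ) (x : S) : Prop :=
  (∃ z, z ≠ x ∧ e z = ε) ∨ ∃ z z', z ≠ z' ∧ e z = 2 * ε ∧ e z' = 2 * ε

theorem Beyond.exists_ne {ε : ℤ} {x : S} (h : Beyond e ε x) (hε : ε ≠ 0) (hx : e x = ε) :
    ∃ z, z ≠ x ∧ (e z = ε ∨ e z = 2 * ε) := by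
  rcases h with ⟨z, hz, h⟩ | ⟨z, -, -, h, -⟩
  · exact ⟨z, hz, Or.inl h⟩
  · refine ⟨z, ?_, Or.inr h⟩
    rintro rfl
    omega

theorem coeff_eq_zero_of_two_sides (h : IsLineup 3 F V e κ) {x y : S} (hx : e x = 1)
    (hy : e y = -1) (hbx : Beyond e 1 x) (hby : Beyond e (-1) y) : κ x = 0 := by
  by_contra hκ
  have hκx : κ x = 1 := by
    have := h.coeff_eq le_rfl (s := x) (by rw [hx]; rfl)
    tauto
  have hxx := h.self x
  have hyy := h.self y
  have hxy := h.pair x y (by rintro rfl; omega)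
  have hyx := dot_comm (V y) (V x)
  rw [hx, hκx] at hxx
  rw [hy] at hyy
  rw [hx, hy, hκx] at hxy
  norm_num at hxx hyy hxy
  have hFx := h.left x
  rw [hκx] at hFx
  have hxF := h.right x
  rw [hκx] at hxF
  have hzx : ∀ z, z ≠ x → (e z = 1 ∨ e z = 2) → dot (V z) (V x) = κ z + 2 := by
    intro z hz hez
    have := h.pair z x hz
    rw [hx, hκx] at this
    rcases hez with hez | hez <;> rw [hez] at this <;> norm_num at this <;> linarith
  have hzy : ∀ z, (e z = 1 ∨ e z = 2) → dot (V z) (V y) = κ z + κ y := by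
    intro z hez
    have := h.pair z y (by rintro rfl; omega)
    rw [hy] at this
    rcases hez with hez | hez <;> rw [hez] at this <;> norm_num at this <;> linarith
  obtain ⟨z, hz, hez⟩ := hbx.exists_ne one_ne_zero hx
  rcases h.coeff_eq le_rfl (s := y) (by rw [hy]; rfl) with hκy | ⟨hκy, -⟩
  · have hFy := h.left y
    have hyF := h.right y
    rw [hκy] at hFy hyF hxy hyy
    have hxy' : dot (V x) (V y) = 1 := by linarith
    rw [hxy'] at hyx
    have hκz : ∀ z, z ≠ x → (e z = 1 ∨ e z = 2) → κ z = 1 := by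
      intro z hz hez
      have h1 := hzx z hz hez
      have h2 := hzy z hez
      rw [hκy] at h2
      have h3 := dot_self_nonneg (V z - κ z • F - (2 - 2 * κ z) • (V x - F)
        - (3 * κ z - 2) • (V y - V x + F))
      simp only [dot_sub_left, dot_sub_right, dot_smul_left, dot_smul_right, dot_add_left,
        dot_add_right, h.sum, h.left, h.right, h.self z, dot_comm _ (V z), h1, h2, hyx, hxy',
        hxx, hyy, hκx, hκy] at h3
      have h4 : |e z| ≤ 2 := by rcases hez with h | h <;> rw [h] <;> norm_num
      have h6 : 16 * κ z ^ 2 - 22 * κ z + 5 ≤ 0 := by linarith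
      have h7 : κ z < 2 := by nlinarith
      have h8 : 0 < κ z := by nlinarith
      omega
    have htx : ∀ t, (e t = -1 ∨ e t = -2) → dot (V t) (V x) = κ t + 1 := by
      intro t het
      have := h.pair t x (by rintro rfl; omega)
      rw [hx, hκx] at this
      rcases het with het | het <;> rw [het] at this <;> norm_num at this <;> linarith
    have hty : ∀ t, t ≠ y → (e t = -1 ∨ e t = -2) → dot (V t) (V y) = κ t + 1 := by
      intro t ht het
      have := h.pair t y ht
      rw [hy, hκy] at this
      rcases het with het | het <;> rw [het] at this <;> norm_num at this <;> linarith
    have hzt : ∀ z t, (e z = 1 ∨ e z = 2) → (e t = -1 ∨ e t = -2) →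
        dot (V z) (V t) = κ z + κ t := by
      intro z t hez het
      have := h.pair z t (by rintro rfl; omega)
      rcases hez with hez | hez <;> rcases het with het | het <;> rw [hez, het] at this <;>
        norm_num at this <;> linarith
    have hκt : ∀ t, t ≠ y → (e t = -1 ∨ e t = -2) → κ t = 0 := by
      intro t ht het
      have h1 := htx t het
      have h2 := hty t ht het
      have h3 := dot_self_nonneg (V t - κ t • F - (1 - 2 * κ t) • (V x - F)
        - (3 * κ t) • (V y - V x + F))
      simp only [dot_sub_left, dot_sub_right, dot_smul_left, dot_smul_right, dot_add_left,
        dot_add_right, h.sum, h.left, h.right, h.self t, dot_comm _ (V t), h1, h2, hyx, hxy',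
        hxx, hyy, hκx, hκy] at h3
      have h4 : |e t| ≤ 2 := by rcases het with h | h <;> rw [h] <;> norm_num
      have h6 : 16 * κ t ^ 2 - 6 * κ t - 2 ≤ 0 := by linarith
      have h7 : κ t < 1 := by nlinarith
      have h8 : -1 < κ t := by nlinarith
      omega
    obtain ⟨t, ht, het⟩ := hby.exists_ne (by norm_num) hy
    have het : e t = -1 ∨ e t = -2 := by omega
    rcases hbx with ⟨z, hz, hez⟩ | ⟨z, z', hzz, hez, hez'⟩
    · have hκ1 := hκz z hz (Or.inl hez)
      have hz0 : V z - V y + V x - (2 : ℤ) • F = 0 := by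
        apply eq_zero_of_dot_self
        simp only [dot_sub_left, dot_sub_right, dot_smul_left, dot_smul_right, dot_add_left,
          dot_add_right, h.sum, h.left, h.right, h.self z, dot_comm _ (V z),
          hzx z hz (Or.inl hez), hzy z (Or.inl hez), hyx, hxy', hxx, hyy, hκx, hκy, hκ1, hez]
        norm_num
      have := congrArg (dot (V t)) hz0
      rw [dot_comm _ 0, dot_zero_left] at this
      simp only [dot_sub_right, dot_smul_right, dot_add_right, dot_comm _ (V z), h.right,
        hzt z t (Or.inl hez) het, htx t het, hty t ht het, hκt t ht het, hκ1] at this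
      omega
    · have hne : ∀ z, e z = 2 * 1 → z ≠ x := by
        rintro z h rfl
        omega
      have hκ1 := hκz z (hne z hez) (by omega)
      have hκ2 := hκz z' (hne z' hez') (by omega)
      have hzz' := h.pair z z' hzz
      rw [hez, hez', hκ1, hκ2] at hzz'
      norm_num at hzz'
      have key : ∀ t, t ≠ y → (e t = -1 ∨ e t = -2) → e t = -2 ∧
          V t - V x + F - (V z - V y + V x - (2 : ℤ) • F)
            - (V z' - V y + V x - (2 : ℤ) • F) = 0 := by
        intro t ht het
        have hsq : dot (V t - V x + F - (V z - V y + V x - (2 : ℤ) • F)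
            - (V z' - V y + V x - (2 : ℤ) • F)) (V t - V x + F - (V z - V y + V x - (2 : ℤ) • F)
            - (V z' - V y + V x - (2 : ℤ) • F)) = |e t| - 2 := by
          simp only [dot_sub_left, dot_sub_right, dot_smul_left, dot_smul_right, dot_add_left,
            dot_add_right, h.sum, h.left, h.right, h.self z, h.self z', h.self t,
            dot_comm (V z') (V z), dot_comm (V x) (V z), dot_comm (V y) (V z),
            dot_comm (V x) (V z'), dot_comm (V y) (V z'), dot_comm (V x) (V t),
            dot_comm (V y) (V t), dot_comm (V t) (V z), dot_comm (V t) (V z'),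
            hzx z (hne z hez) (by omega), hzx z' (hne z' hez') (by omega),
            hzy z (by omega), hzy z' (by omega), hzt z t (by omega) het,
            hzt z' t (by omega) het, htx t het, hty t ht het, hκt t ht het,
            hyx, hxy', hxx, hyy, hκx, hκy, hκ1, hκ2, hez, hez']
          norm_num
          linarith
        have hge := dot_self_nonneg (V t - V x + F - (V z - V y + V x - (2 : ℤ) • F)
            - (V z' - V y + V x - (2 : ℤ) • F))
        have het2 : e t = -2 := by
          rcases het with h | h
          · rw [hsq, h] at hge
            norm_num at hge
          · exact h
        refine ⟨het2, eq_zero_of_dot_self ?_⟩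
        rw [hsq, het2]
        norm_num
      rcases hby with ⟨t, ht, het⟩ | ⟨t, t', htt, het, het'⟩
      · have := (key t ht (Or.inl het)).1
        omega
      · have hne' : ∀ t, e t = 2 * -1 → t ≠ y := by
          rintro t h rfl
          omega
        have k1 := (key t (hne' t het) (by omega)).2
        have k2 := (key t' (hne' t' het') (by omega)).2
        have e0 : V t = V t' := by
          rw [← sub_eq_zero, ← sub_self (0 : Fin N → ℤ)]
          nth_rewrite 1 [← k1]
          rw [← k2]
          abel
        have h1 := h.pair t t' htt
        have h2 := h.self t
        rw [← e0, hκt t (hne' t het) (by omega), hκt t' (hne' t' het') (by omega), h2,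
          hκt t (hne' t het) (by omega), het, het'] at h1
        norm_num at h1
  · have hFy := h.left y
    have hxy' : dot (V x) (V y) = 2 := by linarith
    rw [hxy'] at hyx
    have hz0 : V y + V x - (2 : ℤ) • F = 0 := by
      apply eq_zero_of_dot_self
      simp only [dot_sub_left, dot_sub_right, dot_smul_left, dot_smul_right, dot_add_left,
        dot_add_right, h.sum, h.left, h.right, hyx, hxy', hxx, hyy, hκx, hκy]
      norm_num
    have := congrArg (dot (V z)) hz0
    rw [dot_comm _ 0, dot_zero_left] at this
    simp only [dot_sub_right, dot_smul_right, dot_add_right, h.right, hzx z hz hez, hzy z hez,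
      hκy] at this
    omega

theorem coeff_eq_zero (h : IsLineup m F V e κ) (hm : 3 ≤ m) {x : S} (hx : e x = 1)
    (hbx : Beyond e 1 x) (hy : m = 3 → ∃ y, e y = -1 ∧ Beyond e (-1) y) : κ x = 0 := by
  rcases h.coeff_eq hm (s := x) (by rw [hx]; rfl) with hκ | ⟨hκ, h4⟩
  · exact hκ
  obtain rfl | rfl : m = 3 ∨ m = 4 := by omega
  · obtain ⟨y, hy, hby⟩ := hy rfl
    exact h.coeff_eq_zero_of_two_sides hx hy hbx hby
  · obtain ⟨z, hz, hez⟩ := hbx.exists_ne one_ne_zero hx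
    have h0 : V x - F = 0 := by
      apply eq_zero_of_dot_self
      simp only [dot_sub_left, dot_sub_right, h.sum, h.left, h.right, h.self, hκ, hx]
      norm_num
    have h1 := congrArg (dot (V z)) h0
    rw [dot_comm _ 0, dot_zero_left, dot_sub_right, h.right] at h1
    have h2 := h.pair z x hz
    rw [hx, hκ] at h2
    rcases hez with hez | hez <;> rw [hez] at h2 <;> norm_num at h2 <;> omega

end IsLineup

section DeepVertices

variable {P : List (List ℤ)} {g u v : (ofList P).V}

theorem deg_le_two (v : (ofList P).V) : (ofList P).deg v ≤ 2 := by
  rw [deg_eq]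
  split_ifs <;> omega

theorem exists_opposite (hv : (ofList P).deg v = 2) (h : (ofList P).graph.Adj v u) :
    ∃ u', (ofList P).graph.Adj v u' ∧ (pos u' : ℤ) - pos v = -(pos u - pos v) := by
  rw [deg_eq] at hv
  have h0 : 0 < pos v := by by_contra; split_ifs at hv <;> omega
  have h1 : pos v + 1 < (P.get (comp v)).length := by by_contra; split_ifs at hv; omega
  rcases (adj_iff.1 h).2 with h | h
  · refine ⟨mkV (comp v) (pos v - 1) (by omega), adj_iff.2 ⟨by simp, ?_⟩, ?_⟩
    · rw [pos_mkV]
      omega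
    · rw [pos_mkV]
      omega
  · refine ⟨mkV (comp v) (pos v + 1) h1, adj_iff.2 (by simp), ?_⟩
    simp
    omega

theorem one_le_deg (h : (ofList P).graph.Adj v u) : 1 ≤ (ofList P).deg v := by
  have h1 := (adj_iff.1 h).1
  have h2 := pos_lt u
  rw [deg_eq]
  rw [← h1] at h2
  rcases (adj_iff.1 h).2 with h | h
  · rw [if_pos (by omega : pos v + 1 < _)]
    omega
  · rw [if_pos (by omega : 0 < pos v)]
    omega

theorem isDeep_cases (hg : (ofList P).IsDeep g) (hw : (ofList P).w g ≤ -2) :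
    (ofList P).w g ≤ -5 ∨ (ofList P).w g = -3 ∧ (ofList P).deg g = 0 := by
  rcases hg with ⟨h, -⟩ | ⟨h, h'⟩
  · rw [abs_of_nonpos (by omega)] at h
    exact Or.inl (by omega)
  · refine Or.inr ⟨h, ?_⟩
    have : (ofList P).graph.neighborSet g = ∅ := Set.eq_empty_of_forall_notMem h'
    rw [Config.deg, this, Set.ncard_empty]

theorem not_isShallow (hg : (ofList P).IsDeep g) (h : (ofList P).graph.Adj g u) :
    ¬ (ofList P).IsShallow u := by
  rcases hg with ⟨-, h'⟩ | ⟨-, h'⟩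
  · exact h' u h
  · exact absurd h (h' u)

theorem weight_of_not_isShallow (hu : ¬ (ofList P).IsShallow u)
    (hw : ∀ v, (ofList P).w v ≤ -2) : (ofList P).w u ≤ -5 ∨ (ofList P).w u = -3 ∧
      ∀ v, (ofList P).graph.Adj u v → (ofList P).w v ≤ -4 := by
  have h0 := hw u
  have h1 : (ofList P).w u ≠ -2 := fun h => hu (Or.inl h)
  have h2 : (ofList P).w u ≠ -4 := fun h => hu (Or.inr (Or.inl h))
  by_cases h3 : (ofList P).w u = -3
  · refine Or.inr ⟨h3, fun v hv => ?_⟩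
    have h4 := hw v
    have h5 : (ofList P).w v ≠ -2 := fun h => hu (Or.inr (Or.inr (Or.inl ⟨h3, v, hv, h⟩)))
    have h6 : (ofList P).w v ≠ -3 := fun h => hu (Or.inr (Or.inr (Or.inr ⟨h3, v, hv, h⟩)))
    omega
  · omega

variable {S : Type} [Finite S] {own : S → (ofList P).V} {X : S → Fin N → ℤ}

theorem IsPlacing.exists_slot (hX : IsPlacing P N own X)
    (h : ((ofList P).deg v : ℤ) < -(ofList P).w v) : ∃ s, own s = v := by
  have h1 := hX.card v
  have : 0 < Nat.card {s // own s = v} := by omega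
  obtain ⟨⟨s, hs⟩⟩ := (Nat.card_pos_iff.1 this).1
  exact ⟨s, hs⟩

theorem IsPlacing.exists_slots (hX : IsPlacing P N own X)
    (h : ((ofList P).deg v : ℤ) + 2 ≤ -(ofList P).w v) :
    ∃ s s', s ≠ s' ∧ own s = v ∧ own s' = v := by
  have h1 := hX.card v
  have : 1 < Nat.card {s // own s = v} := by omega
  have := Finite.one_lt_card_iff_nontrivial.1 this
  obtain ⟨⟨s, hs⟩, ⟨s', hs'⟩, hne⟩ := this
  exact ⟨s, s', fun h => hne (Subtype.ext h), hs, hs'⟩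

theorem IsPlacing.exists_slot_of_adj (hX : IsPlacing P N own X)
    (hw : ∀ v, (ofList P).w v ≤ -2) (hg : (ofList P).IsDeep g)
    (h : (ofList P).graph.Adj g u) : ∃ s, own s = u := by
  have h1 := deg_le_two u
  have h2 := weight_of_not_isShallow (not_isShallow hg h) hw
  exact hX.exists_slot (by omega)

theorem IsPlacing.exists_beyond (hX : IsPlacing P N own X)
    (hw : ∀ v, (ofList P).w v ≤ -2) (hg : (ofList P).IsDeep g)
    (h : (ofList P).graph.Adj g u) (s : S) :
    (∃ z, z ≠ s ∧ own z = u) ∨ ∃ z z', z ≠ z' ∧ own z = own z' ∧ comp (own z) = comp g ∧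
      (pos (own z) : ℤ) - pos g = 2 * (pos u - pos g) := by
  have h1 := deg_le_two u
  by_cases h2 : ((ofList P).deg u : ℤ) + 2 ≤ -(ofList P).w u
  · left
    obtain ⟨z, z', hne, hz, hz'⟩ := hX.exists_slots h2
    by_cases hzs : z = s
    · exact ⟨z', hzs ▸ hne.symm, hz'⟩
    · exact ⟨z, hzs, hz⟩
  · right
    rcases weight_of_not_isShallow (not_isShallow hg h) hw with h3 | ⟨h3, h4⟩
    · omega
    · obtain ⟨u', hu', hp⟩ := exists_opposite (by omega) h.symm
      have h5 := h4 u' hu'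
      have h6 := deg_le_two u'
      obtain ⟨z, z', hne, hz, hz'⟩ := hX.exists_slots (v := u') (by omega)
      refine ⟨z, z', hne, by rw [hz, hz'], ?_, ?_⟩
      · rw [hz, ← (adj_iff.1 hu').1, (adj_iff.1 h).1]
      · rw [hz]
        omega

theorem IsPlacing.three_le_card (hX : IsPlacing P N own X)
    (hw : ∀ v, (ofList P).w v ≤ -2) (hg : (ofList P).IsDeep g) :
    3 ≤ Nat.card {s // own s = g} := by
  have h1 := deg_le_two g
  have h2 := isDeep_cases hg (hw g)
  have h3 := hX.card g
  omega

theorem IsPlacing.exists_orthon (hX : IsPlacing P N own X)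
    (hw : ∀ v, (ofList P).w v ≤ -2) (hg : (ofList P).IsDeep g) :
    ∃ O, Orthon fun t : {t // own t = g} => X t - O := by
  have := Fintype.ofFinite {t // own t = g}
  have h3 := hX.three_le_card hw hg
  refine exists_origin (fun t : {t // own t = g} => X t) ?_ ?_ ?_
  · intro s t hst
    rw [hX.same s t (fun h => hst (Subtype.ext h)) (by rw [s.2, t.2]), s.2, t.2]
    simp
  · rwa [← Nat.card_eq_fintype_card]
  · rw [← Nat.card_eq_fintype_card]
    by_cases h4 : Nat.card {s // own s = g} = 4
    · right
      have h1 := deg_le_two g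
      have h2 := isDeep_cases hg (hw g)
      have h5 := hX.card g
      have h6 : 0 < (ofList P).deg g := by omega
      obtain ⟨u, hu⟩ := Set.nonempty_of_ncard_ne_zero h6.ne'
      have hu : (ofList P).graph.Adj g u := hu
      obtain ⟨s, hs⟩ := hX.exists_slot_of_adj hw hg hu
      refine ⟨X s, 2 + |(pos u : ℤ) - pos g|, fun t => ?_⟩
      rw [hX.same s t (fun h => hu.ne (by rw [← hs, ← t.2, h])), hs, t.2]
      rw [hs, t.2]
      exact (adj_iff.1 hu).1.symm
    · exact Or.inl h4

theorem IsPlacing.dot_eq (hX : IsPlacing P N own X) {O : Fin N → ℤ}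
    (hO : Orthon fun t : {t // own t = g} => X t - O) {s t t' : S} (hs : own s ≠ g)
    (hc : comp (own s) = comp g) (ht : own t = g) (ht' : own t' = g) :
    dot (X s - O) (X t - O) = dot (X s - O) (X t' - O) := by
  have h1 := hX.dist_origin ht (hO.1 ⟨t, ht⟩) hs hc
  have h2 := hX.dist_origin ht' (hO.1 ⟨t', ht'⟩) hs hc
  linarith

theorem IsPlacing.isLineup [Fintype {t // own t = g}] (hX : IsPlacing P N own X) {O : Fin N → ℤ}
    (hO : Orthon fun t : {t // own t = g} => X t - O) {t : S} (ht : own t = g) {ε : ℤ}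
    (hε : |ε| = 1) :
    IsLineup (Nat.card {t // own t = g}) (∑ t : {t // own t = g}, (X t - O))
      (fun s : {s // own s ≠ g ∧ comp (own s) = comp g} => X s - O)
      (fun s => ε * (pos (own s) - pos g)) fun s => dot (X s - O) (X t - O) where
  sum := by
    rw [dot_sum_left, Finset.sum_congr rfl fun s _ => ?_, Finset.sum_const, Finset.card_univ,
      Nat.card_eq_fintype_card, nsmul_eq_mul, mul_one]
    rw [dot_comm, dot_sum_left, Finset.sum_eq_single s, hO.1 s]
    · exact fun r _ hr => hO.2 r s hr
    · simp
  left s := by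
    rw [dot_sum_left, Finset.sum_congr rfl fun r _ => ?_, Finset.sum_const, Finset.card_univ,
      Nat.card_eq_fintype_card, nsmul_eq_mul]
    rw [dot_comm, hX.dot_eq hO s.2.1 s.2.2 r.2 ht]
  self s := by
    rw [hX.dist_origin ht (hO.1 ⟨t, ht⟩) s.2.1 s.2.2, abs_mul, hε, one_mul]
  pair s r hsr := by
    have h1 := hX.same s r (fun h => hsr (Subtype.ext h)) (by rw [s.2.2, r.2.2])
    rw [← sub_sub_sub_cancel_right (X s) (X r) O, dot_sub_self,
      hX.dist_origin ht (hO.1 ⟨t, ht⟩) s.2.1 s.2.2,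
      hX.dist_origin ht (hO.1 ⟨t, ht⟩) r.2.1 r.2.2] at h1
    rw [← mul_sub, abs_mul, abs_mul, abs_mul, hε, sub_sub_sub_cancel_right]
    linarith

theorem IsPlacing.dot_eq_zero_of_adj (hX : IsPlacing P N own X)
    (hw : ∀ v, (ofList P).w v ≤ -2) (hg : (ofList P).IsDeep g) {O : Fin N → ℤ}
    (hO : Orthon fun t : {t // own t = g} => X t - O) {s t : S}
    (hs : (ofList P).graph.Adj g (own s)) (ht : own t = g) :
    dot (X s - O) (X t - O) = 0 := by
  have := Fintype.ofFinite {t // own t = g}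
  have hε : |(pos (own s) : ℤ) - pos g| = 1 := by
    rcases (adj_iff.1 hs).2 with h | h
    · rw [abs_eq] <;> omega
    · rw [abs_eq] <;> omega
  set ε : ℤ := (pos (own s) : ℤ) - pos g with hε'
  have hεε : ε * ε = 1 := by rw [← abs_mul_abs_self, hε]; rfl
  have hL := hX.isLineup hO ht hε
  have beyond : ∀ (y : S) (hy : (ofList P).graph.Adj g (own y)) (δ : ℤ)
      (hδ : ε * ((pos (own y) : ℤ) - pos g) = δ), IsLineup.Beyond
      (fun s : {s // own s ≠ g ∧ comp (own s) = comp g} => ε * ((pos (own s) : ℤ) - pos g)) δ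
      ⟨y, hy.ne', (adj_iff.1 hy).1.symm⟩ := by
    rintro y hy δ rfl
    rcases hX.exists_beyond hw hg hy y with ⟨z, hz, h⟩ | ⟨z, z', hz, h, hc, hp⟩
    · refine Or.inl ⟨⟨z, by rw [h]; exact hy.ne', by rw [h]; exact (adj_iff.1 hy).1.symm⟩,
        fun hh => hz (congrArg Subtype.val hh), ?_⟩
      simp only [h]
    · have hne : own z ≠ g := by
        intro hh
        have := (adj_iff.1 hy).2
        rw [hh] at hp
        omega
      refine Or.inr ⟨⟨z, hne, hc⟩, ⟨z', h ▸ hne, h ▸ hc⟩,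
        fun hh => hz (congrArg Subtype.val hh), ?_, ?_⟩
      · simp only [hp]
        ring
      · simp only [← h, hp]
        ring
  refine hL.coeff_eq_zero (x := ⟨s, hs.ne', (adj_iff.1 hs).1.symm⟩) ?_ hεε (beyond s hs 1 hεε) ?_
  · exact_mod_cast hX.three_le_card hw hg
  · intro h3
    have h1 := hX.card g
    have h2 := isDeep_cases hg (hw g)
    have h4 := one_le_deg hs
    have h5 := deg_le_two g
    obtain ⟨u, hu, hp⟩ := exists_opposite (by omega) hs
    obtain ⟨y, rfl⟩ := hX.exists_slot_of_adj hw hg hu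
    have : ε * ((pos (own y) : ℤ) - pos g) = -1 := by rw [hp, ← hε', mul_neg, hεε]
    exact ⟨⟨y, hu.ne', (adj_iff.1 hu).1.symm⟩, this, beyond y hu _ this⟩

end DeepVertices

theorem Orthon.dot_ne_neg_one {ι : Type*} [Fintype ι] {f : ι → Fin N → ℤ} (hf : Orthon f)
    (hι : 3 ≤ Fintype.card ι) {u y : Fin N → ℤ} {c c' : ℤ} (hc : c ≠ 0)
    (hu : ∀ i, dot u (f i) = c) (huu : dot u u = 3) (hy : ∀ i, dot y (f i) = c') :
    dot y u ≠ -1 := by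
  have hc1 : 1 ≤ c ^ 2 := by have := sq_pos_of_ne_zero hc; omega
  have h1 := hf.bessel Finset.univ u
  have h2 := hf.eq_sum Finset.univ u
  simp only [hu, Finset.sum_const, Finset.card_univ, huu, nsmul_eq_mul] at h1 h2
  have hι' : (3 : ℤ) ≤ Fintype.card ι := by exact_mod_cast hι
  have h3 : (Fintype.card ι : ℤ) = 3 := by nlinarith
  have h4 : dot y u = 3 * (c * c') := by
    rw [h2 (by nlinarith), dot_comm, dot_sum_left]
    simp only [dot_smul_left]
    simp only [dot_comm _ y, hy, Finset.sum_const, Finset.card_univ, nsmul_eq_mul, h3]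
  omega

section Counting

variable {P : List (List ℤ)} {g u v : (ofList P).V}
  {S : Type} [Finite S] {own : S → (ofList P).V} {X : S → Fin N → ℤ}

namespace IsPlacing

theorem dot_step_step (hX : IsPlacing P N own X) {s r t : S} (hsr : s ≠ r) (hrt : r ≠ t)
    (hst : s ≠ t) (hc : comp (own s) = comp (own r)) (hc' : comp (own r) = comp (own t))
    (hp : pos (own s) ≤ pos (own r)) (hp' : pos (own r) ≤ pos (own t)) :
    dot (X r - X s) (X t - X r) = -1 := by
  have h1 := hX.same s r hsr hc
  have h2 := hX.same r t hrt hc'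
  have h3 := hX.same s t hst (hc.trans hc')
  rw [abs_of_nonpos (by omega)] at h1 h2 h3
  simp only [dot_sub_left, dot_sub_right, dot_comm (X r) (X s), dot_comm (X t) (X s),
    dot_comm (X t) (X r)] at h1 h2 h3 ⊢
  omega

theorem coeff_const (hX : IsPlacing P N own X) {O : Fin N → ℤ}
    (hO : Orthon fun t : {t // own t = g} => X t - O) {s s' t t' : S} (hs : own s ≠ g)
    (hs' : own s' ≠ g) (hc : comp (own s) = comp (own s')) (ht : own t = g) (ht' : own t' = g) :
    dot (X s - X s') (X t - O) = dot (X s - X s') (X t' - O) := by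
  by_cases h : comp (own s) = comp g
  · rw [← sub_sub_sub_cancel_right (X s) (X s') O, dot_sub_left (X s - O),
      dot_sub_left (X s - O), hX.dot_eq hO hs h ht ht', hX.dot_eq hO hs' (hc ▸ h) ht ht']
  · have := hX.orth s s' t t' hc (by rw [ht, ht']) (by rwa [ht])
    rw [← sub_eq_zero, ← dot_sub_right, sub_sub_sub_cancel_right, this]

end IsPlacing

/-- The origin `O` of `g` is incompatible with the step from `s` to `r`. -/
structure Blocks (own : S → (ofList P).V) (X : S → Fin N → ℤ) (g : (ofList P).V)
    (O : Fin N → ℤ) (s r : S) : Prop where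
  orthon : Orthon fun t : {t // own t = g} => X t - O
  left_ne : own s ≠ g
  right_ne : own r ≠ g
  coeff : ∀ t, own t = g → dot (X r - X s) (X t - O) ≠ 0

namespace IsPlacing

theorem own_eq_of_blocks (hX : IsPlacing P N own X) (h3 : 3 ≤ Nat.card {t // own t = g})
    {O : Fin N → ℤ} {s r n : S} (hB : Blocks own X g O s r) (hc : comp (own s) = comp (own r))
    (hp : pos (own r) = pos (own s) + 1) (hns : n ≠ s) (hnr : n ≠ r)
    (hn : comp (own n) = comp (own s))
    (hn' : pos (own n) ≤ pos (own s) ∨ pos (own r) ≤ pos (own n)) : own n = g := by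
  by_contra hg
  have := Fintype.ofFinite {t // own t = g}
  rw [Nat.card_eq_fintype_card] at h3
  obtain ⟨⟨t, ht⟩⟩ : Nonempty {t // own t = g} := Fintype.card_pos_iff.1 (by omega)
  have hsr : s ≠ r := by
    rintro rfl
    omega
  have huu := hX.same r s hsr.symm hc.symm
  rw [hp] at huu
  push_cast at huu
  rw [add_sub_cancel_left] at huu
  have hu : ∀ t' : {t // own t = g}, dot (X r - X s) (X t' - O) = dot (X r - X s) (X t - O) :=
    fun t' => hX.coeff_const hB.orthon hB.right_ne hB.left_ne hc.symm t'.2 ht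
  rcases hn' with h | h
  · exact hB.orthon.dot_ne_neg_one h3 (hB.coeff t ht) hu huu
      (fun t' => hX.coeff_const hB.orthon hB.left_ne hg hn.symm t'.2 ht)
      (hX.dot_step_step hns hsr hnr hn hc h (by omega))
  · refine hB.orthon.dot_ne_neg_one h3 (hB.coeff t ht) hu huu
      (fun t' => hX.coeff_const hB.orthon hg hB.right_ne (hn.trans hc) t'.2 ht) ?_
    rw [dot_comm]
    exact hX.dot_step_step hsr hnr.symm hns.symm hc (hn.trans hc).symm (by omega) h

theorem card_le_of_blocks (hX : IsPlacing P N own X) {K : Type} [Fintype K]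
    {γ : K → (ofList P).V} (hγ : Function.Injective γ)
    (h3 : ∀ a, 3 ≤ Nat.card {t // own t = γ a}) {O : K → Fin N → ℤ} {s r : S}
    (hB : ∀ a, Blocks own X (γ a) (O a) s r) :
    3 * (Fintype.card K : ℤ) ≤ dot (X r - X s) (X r - X s) := by
  classical
  have inst : ∀ a, Fintype {t // own t = γ a} := fun a => Fintype.ofFinite _
  have hO : Orthon fun p : (a : K) × {t // own t = γ a} => X p.2 - O p.1 := by
    refine ⟨fun p => (hB p.1).orthon.1 p.2, ?_⟩
    rintro ⟨a, t⟩ ⟨b, t'⟩ hne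
    by_cases hab : a = b
    · subst hab
      exact (hB a).orthon.2 t t' fun h => hne (by rw [h])
    · refine (hB a).orthon.cross (hB b).orthon ?_ ?_ ?_ t t'
      · rw [← Nat.card_eq_fintype_card]
        exact h3 a
      · rw [← Nat.card_eq_fintype_card]
        exact h3 b
      · intro i j k l
        rw [sub_sub_sub_cancel_right, sub_sub_sub_cancel_right]
        by_cases hc : comp (γ a) = comp (γ b)
        · have hne : ∀ (i : {t // own t = γ a}) (k : {t // own t = γ b}), (i : S) ≠ k :=
            fun i k h => hab (hγ (by rw [← i.2, ← k.2, h]))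
          have hd := fun (i : {t // own t = γ a}) (k : {t // own t = γ b}) =>
            hX.same i k (hne i k) (by rw [i.2, k.2, hc])
          have e1 := hd i k
          have e2 := hd i l
          have e3 := hd j k
          have e4 := hd j l
          rw [i.2, k.2] at e1
          rw [i.2, l.2] at e2
          rw [j.2, k.2] at e3
          rw [j.2, l.2] at e4
          rw [dot_sub_self] at e1 e2 e3 e4
          simp only [dot_sub_left, dot_sub_right]
          omega
        · exact hX.orth i j k l (by rw [i.2, j.2]) (by rw [k.2, l.2]) (by rwa [i.2, k.2])
  refine le_trans ?_ (hO.bessel Finset.univ (X r - X s))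
  have h1 : ∀ p ∈ (Finset.univ : Finset ((a : K) × {t // own t = γ a})),
      (1 : ℤ) ≤ dot (X r - X s) (X p.2 - O p.1) ^ 2 := by
    intro p _
    have := sq_pos_of_ne_zero ((hB p.1).coeff p.2 p.2.2)
    omega
  refine le_trans ?_ (Finset.sum_le_sum h1)
  rw [Finset.sum_const, Finset.card_univ, Fintype.card_sigma, nsmul_eq_mul, mul_one]
  push_cast
  rw [mul_comm, ← nsmul_eq_mul, ← Finset.card_univ, ← Finset.sum_const]
  refine Finset.sum_le_sum fun a _ => ?_
  rw [← Nat.card_eq_fintype_card]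
  exact_mod_cast h3 a

end IsPlacing

end Counting

section Counting

variable {P D : List (List ℤ)} {g : (ofList P).V} {ow : Slots D → (ofList P).V}
  {X : Slots D → Fin N → ℤ}

theorem IsSlotMap.exists_blocks (how : IsSlotMap P D ow) (hX : IsPlacing P N ow X)
    (hw : ∀ v, (ofList P).w v ≤ -2) (hg : (ofList P).IsDeep g) {O : Fin N → ℤ}
    (hO : Orthon fun t : {t // ow t = g} => X t - O) (hr : ¬ IsRemovable ow X g O) :
    ∃ q : (i : Fin D.length) × Fin (D.get i).length,
      Blocks ow X g O ⟨q.1, q.2.castSucc⟩ ⟨q.1, q.2.succ⟩ := by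
  by_contra hno
  apply hr
  have hstep : ∀ (i : Fin D.length) (j : Fin (D.get i).length), ow ⟨i, j.castSucc⟩ ≠ g →
      ow ⟨i, j.succ⟩ ≠ g → ∀ t, ow t = g →
      dot (X ⟨i, j.succ⟩ - X ⟨i, j.castSucc⟩) (X t - O) = 0 := by
    intro i j h1 h2 t ht
    by_contra h0
    refine hno ⟨⟨i, j⟩, hO, h1, h2, fun t' ht' => ?_⟩
    rwa [hX.coeff_const hO h2 h1 (how.comp_eq_iff.2 rfl) ht' ht]
  have hadj : ∀ s, (ofList P).graph.Adj g (ow s) → ∀ t, ow t = g →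
      dot (X s - O) (X t - O) = 0 := fun s hs t ht => hX.dot_eq_zero_of_adj hw hg hO hs ht
  refine ⟨hO, ?_, ?_⟩
  · rintro ⟨i, j⟩ hj hc t ht
    obtain ⟨i', jt⟩ := t
    have hts : comp (ow ⟨i', jt⟩) = comp (ow ⟨i, j⟩) := by rw [ht]; exact hc.symm
    have hi : i' = i := how.comp_eq_iff.1 hts
    subst hi
    have hmono := how.mono i'
    have hcomp : ∀ j, comp (ow ⟨i', j⟩) = comp g := by
      intro l
      rw [← hc]
      exact how.comp_eq_iff.2 rfl
    have hne : ∀ j, ow ⟨i', j⟩ ≠ g → pos (ow ⟨i', j⟩) ≠ pos g :=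
      fun j h h' => h (vertex_ext (hcomp j) h')
    have hslot : ∀ u, (ofList P).graph.Adj g u → ∃ j, ow ⟨i', j⟩ = u := by
      intro u hu
      obtain ⟨⟨i, l⟩, hs⟩ := hX.exists_slot_of_adj hw hg hu
      have hst : comp (ow ⟨i, l⟩) = comp (ow ⟨i', jt⟩) := by rw [hs, ht, (adj_iff.1 hu).1]
      have : i = i' := how.comp_eq_iff.1 hst
      subst this
      exact ⟨l, hs⟩
    rcases lt_or_gt_of_ne (hne j hj) with hlt | hgt
    · clear hj hc hts
      revert hlt
      induction j using Fin.reverseInduction with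
      | last =>
        intro hlt
        have := hmono (Fin.le_last jt)
        simp only [ht] at this
        omega
      | cast j ih =>
        intro hlt
        by_cases h : pos (ow ⟨i', j.succ⟩) < pos g
        · have h1 := ih h
          have h2 := hstep i' j (fun h => by rw [h] at hlt; omega)
            (fun h' => by rw [h'] at h; omega) _ ht
          rw [← sub_sub_sub_cancel_right _ _ O, dot_sub_left, h1] at h2
          omega
        · have hlen := pos_lt g
          obtain ⟨l, hl⟩ := hslot (mkV (comp g) (pos g - 1) (by omega))
            (adj_iff.2 ⟨by simp, by rw [pos_mkV]; omega⟩)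
          have hl1 : pos (ow ⟨i', l⟩) = pos g - 1 := by rw [hl, pos_mkV]
          have hl2 : l ≤ j.castSucc := by
            by_contra hlj
            have := hmono (Fin.castSucc_lt_iff_succ_le.1 (not_le.1 hlj))
            simp only at this
            omega
          have := hmono hl2
          simp only at this
          refine hadj _ (adj_iff.2 ⟨(hcomp _).symm, ?_⟩) _ ht
          omega
    · clear hj hc hts
      revert hgt
      induction j using Fin.induction with
      | zero =>
        intro hgt
        have := hmono (Fin.zero_le jt)
        simp only [ht] at this
        omega
      | succ j ih =>
        intro hgt
        by_cases h : pos g < pos (ow ⟨i', j.castSucc⟩)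
        · have h1 := ih h
          have h2 := hstep i' j (fun h' => by rw [h'] at h; omega)
            (fun h => by rw [h] at hgt; omega) _ ht
          rw [← sub_sub_sub_cancel_right _ _ O, dot_sub_left, h1] at h2
          omega
        · have hlen := pos_lt (ow ⟨i', j.succ⟩)
          rw [hcomp] at hlen
          obtain ⟨l, hl⟩ := hslot (mkV (comp g) (pos g + 1) (by omega))
            (adj_iff.2 ⟨by simp, by rw [pos_mkV]; omega⟩)
          have hl1 : pos (ow ⟨i', l⟩) = pos g + 1 := by rw [hl, pos_mkV]
          have hl2 : j.succ ≤ l := by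
            by_contra hlj
            have := hmono (Fin.le_castSucc_iff.2 (not_le.1 hlj))
            simp only at this
            omega
          have := hmono hl2
          simp only at this
          refine hadj _ (adj_iff.2 ⟨(hcomp _).symm, ?_⟩) _ ht
          omega
  · rintro ⟨i, j⟩ ⟨i', j'⟩ hc hne t ht
    have hi : i = i' := how.comp_eq_iff.1 hc
    subst hi
    have hcomp : ∀ j, ow ⟨i, j⟩ ≠ g := by
      rintro j rfl
      exact hne (how.comp_eq_iff.2 rfl)
    have key : ∀ j, dot (X ⟨i, j⟩) (X t - O) = dot (X ⟨i, 0⟩) (X t - O) := by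
      intro j
      induction j using Fin.induction with
      | zero => rfl
      | succ j ih => rw [← ih, ← sub_eq_zero, ← dot_sub_left, hstep i j (hcomp _) (hcomp _) t ht]
    rw [dot_sub_left, key, key j', sub_self]

end Counting

section Counting

variable {P D : List (List ℤ)} {v : (ofList P).V} {ow : Slots D → (ofList P).V}
  {X : Slots D → Fin N → ℤ}

theorem IsSlotMap.exists_slot_of_deg_le_one (how : IsSlotMap P D ow)
    (hw : ∀ v, (ofList P).w v ≤ -2) {i : Fin D.length} {j : Fin ((D.get i).length + 1)}
    (hv : comp v = comp (ow ⟨i, j⟩)) (hd : (ofList P).deg v ≤ 1) : ∃ l, ow ⟨i, l⟩ = v := by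
  have h1 := how.card v
  have h2 := hw v
  have h3 : 0 < Nat.card {s // ow s = v} := by omega
  obtain ⟨⟨⟨i', l⟩, hs⟩⟩ := (Nat.card_pos_iff.1 h3).1
  have h4 : comp (ow ⟨i', l⟩) = comp (ow ⟨i, j⟩) := by rw [hs, hv]
  have : i' = i := how.comp_eq_iff.1 h4
  subst this
  exact ⟨l, hs⟩

theorem IsSlotMap.weight_of_between (how : IsSlotMap P D ow)
    (hw : ∀ v, (ofList P).w v ≤ -2) {i : Fin D.length} {j : Fin (D.get i).length}
    (hv : comp v = comp (ow ⟨i, j.castSucc⟩)) (h1 : pos (ow ⟨i, j.castSucc⟩) < pos v)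
    (h2 : pos v < pos (ow ⟨i, j.succ⟩)) : (ofList P).w v = -2 := by
  have hcard := how.card v
  have hemp : IsEmpty {s // ow s = v} := by
    refine ⟨?_⟩
    rintro ⟨⟨i', l⟩, hs⟩
    have h4 : comp (ow ⟨i', l⟩) = comp (ow ⟨i, j.castSucc⟩) := by rw [hs, hv]
    have : i' = i := how.comp_eq_iff.1 h4
    subst this
    rcases le_or_gt l j.castSucc with h | h
    · have := how.mono i' h
      simp only [hs] at this
      omega
    · have := how.mono i' (Fin.castSucc_lt_iff_succ_le.1 h)
      simp only [hs] at this
      omega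
  have h3 := hw v
  have h4 := deg_le_two v
  rw [Nat.card_of_isEmpty] at hcard
  omega

theorem IsSlotMap.weight_of_subsingleton (how : IsSlotMap P D ow)
    (hw : ∀ v, (ofList P).w v ≤ -2) (hd : (ofList P).deg v ≤ 1)
    (hv : ∀ s t, ow s = v → ow t = v → s = t) : (ofList P).w v = -2 := by
  have : Subsingleton {s // ow s = v} := ⟨fun s t => Subtype.ext (hv s t s.2 t.2)⟩
  have h1 := how.card v
  have h2 := Finite.card_le_one_iff_subsingleton.2 this
  have h3 := hw v
  omega

theorem IsSlotMap.weight_of_first (how : IsSlotMap P D ow) (hw : ∀ v, (ofList P).w v ≤ -2)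
    {i : Fin D.length} {j : Fin (D.get i).length} (hj : (j : ℕ) = 0)
    (hlt : pos (ow ⟨i, j.castSucc⟩) < pos (ow ⟨i, j.succ⟩)) :
    (ofList P).w (ow ⟨i, j.castSucc⟩) = -2 := by
  have hlen := pos_lt (ow ⟨i, j.castSucc⟩)
  have hp : pos (ow ⟨i, j.castSucc⟩) = 0 := by
    obtain ⟨l, hl⟩ := how.exists_slot_of_deg_le_one hw
      (v := mkV (comp (ow ⟨i, j.castSucc⟩)) 0 (by omega)) (comp_mkV _ _ _)
      (by rw [deg_eq, pos_mkV, if_neg (lt_irrefl 0)]; split_ifs <;> omega)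
    have := how.mono i (show j.castSucc ≤ l by rw [Fin.le_def, Fin.val_castSucc, hj]; omega)
    simp only [hl, pos_mkV] at this
    omega
  refine how.weight_of_subsingleton hw ?_ ?_
  · rw [deg_eq, hp, if_neg (lt_irrefl 0)]
    split_ifs <;> omega
  · have key : ∀ s, ow s = ow ⟨i, j.castSucc⟩ → s = ⟨i, j.castSucc⟩ := by
      rintro ⟨i', l⟩ hs
      have h4 : comp (ow ⟨i', l⟩) = comp (ow ⟨i, j.castSucc⟩) := by rw [hs]
      have : i' = i := how.comp_eq_iff.1 h4
      subst this
      have hle : l ≤ j.castSucc := by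
        by_contra h
        have := how.mono i' (Fin.castSucc_lt_iff_succ_le.1 (not_le.1 h))
        simp only [hs] at this
        omega
      rw [Fin.le_def, Fin.val_castSucc, hj] at hle
      have : l = j.castSucc := by
        rw [Fin.ext_iff, Fin.val_castSucc]
        omega
      rw [this]
    intro s t hs ht
    rw [key s hs, key t ht]

theorem IsSlotMap.weight_of_last (how : IsSlotMap P D ow) (hw : ∀ v, (ofList P).w v ≤ -2)
    {i : Fin D.length} {j : Fin (D.get i).length} (hj : (j : ℕ) + 1 = (D.get i).length)
    (hlt : pos (ow ⟨i, j.castSucc⟩) < pos (ow ⟨i, j.succ⟩)) :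
    (ofList P).w (ow ⟨i, j.succ⟩) = -2 := by
  have hlen := pos_lt (ow ⟨i, j.succ⟩)
  have hp : pos (ow ⟨i, j.succ⟩) + 1 = (P.get (comp (ow ⟨i, j.succ⟩))).length := by
    obtain ⟨l, hl⟩ := how.exists_slot_of_deg_le_one hw
      (v := mkV (comp (ow ⟨i, j.succ⟩)) ((P.get (comp (ow ⟨i, j.succ⟩))).length - 1) (by omega))
      (comp_mkV _ _ _) (by rw [deg_eq, pos_mkV, comp_mkV]; split_ifs <;> omega)
    have := how.mono i (show l ≤ j.succ by rw [Fin.le_def, Fin.val_succ]; omega)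
    simp only [hl, pos_mkV] at this
    omega
  refine how.weight_of_subsingleton hw ?_ ?_
  · rw [deg_eq, hp, if_neg (lt_irrefl _)]
    split_ifs <;> omega
  · have key : ∀ s, ow s = ow ⟨i, j.succ⟩ → s = ⟨i, j.succ⟩ := by
      rintro ⟨i', l⟩ hs
      have h4 : comp (ow ⟨i', l⟩) = comp (ow ⟨i, j.succ⟩) := by rw [hs]
      have : i' = i := how.comp_eq_iff.1 h4
      subst this
      have hle : j.succ ≤ l := by
        by_contra h
        have := how.mono i' (Fin.le_castSucc_iff.2 (not_le.1 h))
        simp only [hs] at this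
        omega
      rw [Fin.le_def, Fin.val_succ] at hle
      have : l = j.succ := by
        rw [Fin.ext_iff, Fin.val_succ]
        omega
      rw [this]
    intro s t hs ht
    rw [key s hs, key t ht]

/-- Each step blocking a number of deep vertices accounts for as many vertices of weight `-2`
near that step. -/
theorem IsSlotMap.exists_separated (how : IsSlotMap P D ow) (hX : IsPlacing P N ow X)
    (hw : ∀ v, (ofList P).w v ≤ -2) {i : Fin D.length} {j : Fin (D.get i).length} {K : Type}
    [Fintype K] {γ : K → (ofList P).V} (hγ : Function.Injective γ)
    (h3 : ∀ a, 3 ≤ Nat.card {t // ow t = γ a}) {O : K → Fin N → ℤ}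
    (hB : ∀ a, Blocks ow X (γ a) (O a) ⟨i, j.castSucc⟩ ⟨i, j.succ⟩) :
    ∃ v : K → (ofList P).V,
      (∀ a, (ofList P).w (v a) = -2 ∧ comp (v a) = comp (ow ⟨i, j.castSucc⟩) ∧
        ((j : ℕ) + 1 = (D.get i).length ∨ pos (v a) < pos (ow ⟨i, j.succ⟩)) ∧
        ((j : ℕ) = 0 ∨ pos (ow ⟨i, j.castSucc⟩) < pos (v a))) ∧
      ∀ a b, a ≠ b → pos (v a) + 1 < pos (v b) ∨ pos (v b) + 1 < pos (v a) := by
  have hcomp : ∀ a b : Fin ((D.get i).length + 1), comp (ow ⟨i, a⟩) = comp (ow ⟨i, b⟩) :=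
    fun a b => how.comp_eq_iff.2 rfl
  have hslot : ∀ {a b : Fin ((D.get i).length + 1)}, (a : ℕ) ≠ b →
      (⟨i, a⟩ : Slots D) ≠ ⟨i, b⟩ := by
    rintro a b hab h
    cases h
    exact hab rfl
  have hmono : pos (ow ⟨i, j.castSucc⟩) ≤ pos (ow ⟨i, j.succ⟩) :=
    how.mono i j.castSucc_lt_succ.le
  have hlen := pos_lt (ow ⟨i, j.succ⟩)
  rw [hcomp _ j.castSucc] at hlen
  have hK := hX.card_le_of_blocks hγ h3 hB
  rw [hX.same _ _ (hslot (by simp)) (hcomp _ _), abs_of_nonneg (by omega)] at hK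
  by_cases hgap : 2 * Fintype.card K ≤ pos (ow ⟨i, j.succ⟩) - pos (ow ⟨i, j.castSucc⟩)
  · let e := Fintype.equivFin K
    have he : ∀ a, (e a : ℕ) < Fintype.card K := fun a => (e a).2
    refine ⟨fun a => mkV (comp (ow ⟨i, j.castSucc⟩))
      (pos (ow ⟨i, j.castSucc⟩) + 1 + 2 * e a) (by have := he a; omega), fun a => ?_, ?_⟩
    · have := he a
      refine ⟨how.weight_of_between hw (comp_mkV _ _ _) ?_ ?_, comp_mkV _ _ _, Or.inr ?_,
        Or.inr ?_⟩ <;> rw [pos_mkV] <;> omega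
    · intro a b hab
      have : (e a : ℕ) ≠ e b := fun h => hab (e.injective (Fin.ext h))
      simp only [pos_mkV]
      omega
  · have hK1 : Fintype.card K = 1 := by omega
    have hp : pos (ow ⟨i, j.succ⟩) = pos (ow ⟨i, j.castSucc⟩) + 1 := by omega
    have hsub : ∀ a b : K, a = b :=
      (Fintype.card_le_one_iff).1 hK1.le
    obtain ⟨a⟩ : Nonempty K := Fintype.card_pos_iff.1 (by omega)
    by_cases h0 : (j : ℕ) = 0
    · exact ⟨fun _ => ow ⟨i, j.castSucc⟩, fun _ => ⟨how.weight_of_first hw h0 (by omega), rfl,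
        Or.inr (by simp only; omega), Or.inl h0⟩, fun a b hab => absurd (hsub a b) hab⟩
    by_cases h1 : (j : ℕ) + 1 = (D.get i).length
    · exact ⟨fun _ => ow ⟨i, j.succ⟩, fun _ => ⟨how.weight_of_last hw h1 (by omega), hcomp _ _,
        Or.inl h1, Or.inr (by simp only; omega)⟩, fun a b hab => absurd (hsub a b) hab⟩
    exfalso
    have hj := j.2
    let n₁ : Fin ((D.get i).length + 1) := ⟨j - 1, by omega⟩
    let n₂ : Fin ((D.get i).length + 1) := ⟨j + 2, by omega⟩
    have m₁ : pos (ow ⟨i, n₁⟩) ≤ pos (ow ⟨i, j.castSucc⟩) :=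
      how.mono i (show n₁ ≤ j.castSucc from Fin.le_def.2 (by simp [n₁]))
    have m₂ : pos (ow ⟨i, j.succ⟩) ≤ pos (ow ⟨i, n₂⟩) :=
      how.mono i (show j.succ ≤ n₂ from Fin.le_def.2 (by simp [n₂]))
    have e₁ := hX.own_eq_of_blocks (h3 a) (hB a) (n := ⟨i, n₁⟩) (hcomp _ _) hp
      (hslot (by simp [n₁]; omega)) (hslot (by simp [n₁])) (hcomp _ _) (Or.inl m₁)
    have e₂ := hX.own_eq_of_blocks (h3 a) (hB a) (n := ⟨i, n₂⟩) (hcomp _ _) hp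
      (hslot (by simp [n₂])) (hslot (by simp [n₂])) (hcomp _ _) (Or.inr m₂)
    rw [e₁] at m₁
    rw [e₂] at m₂
    omega

end Counting

section Finale

variable {P D : List (List ℤ)} {ow : Slots D → (ofList P).V} {X : Slots D → Fin N → ℤ}

theorem IsSlotMap.exists_twos (how : IsSlotMap P D ow) (hX : IsPlacing P N ow X)
    (hw : ∀ v, (ofList P).w v ≤ -2) {K : Type} [Finite K] {γ : K → (ofList P).V}
    (hγ : Function.Injective γ) (hdeep : ∀ a, (ofList P).IsDeep (γ a)) {O : K → Fin N → ℤ}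
    {q : K → (i : Fin D.length) × Fin (D.get i).length}
    (hB : ∀ a, Blocks ow X (γ a) (O a) ⟨(q a).1, (q a).2.castSucc⟩ ⟨(q a).1, (q a).2.succ⟩) :
    ∃ χ : K → (ofList P).V, (∀ a, (ofList P).w (χ a) = -2) ∧
      ∀ a b, a ≠ b → comp (χ a) = comp (χ b) →
        pos (χ a) + 1 < pos (χ b) ∨ pos (χ b) + 1 < pos (χ a) := by
  have hloc : ∀ p : (i : Fin D.length) × Fin (D.get i).length,
      ∃ v : {a // q a = p} → (ofList P).V,
        (∀ a, (ofList P).w (v a) = -2 ∧ comp (v a) = comp (ow ⟨p.1, p.2.castSucc⟩) ∧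
          ((p.2 : ℕ) + 1 = (D.get p.1).length ∨ pos (v a) < pos (ow ⟨p.1, p.2.succ⟩)) ∧
          ((p.2 : ℕ) = 0 ∨ pos (ow ⟨p.1, p.2.castSucc⟩) < pos (v a))) ∧
        ∀ a b, a ≠ b → pos (v a) + 1 < pos (v b) ∨ pos (v b) + 1 < pos (v a) := by
    intro p
    have := Fintype.ofFinite {a // q a = p}
    refine how.exists_separated hX hw (γ := fun a : {a // q a = p} => γ a) (O := fun a => O a)
      (fun a b h => Subtype.ext (hγ h)) (fun a => hX.three_le_card hw (hdeep a)) ?_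
    rintro ⟨a, rfl⟩
    exact hB a
  choose v hv hsep using hloc
  have htrans : ∀ p a (e : q a = p), v (q a) ⟨a, rfl⟩ = v p ⟨a, e⟩ := by
    rintro p a rfl
    rfl
  have key : ∀ a b (i : Fin D.length) (j j' : Fin (D.get i).length), q a = ⟨i, j⟩ →
      q b = ⟨i, j'⟩ → j < j' → pos (v _ ⟨a, rfl⟩) + 1 < pos (v _ ⟨b, rfl⟩) := by
    intro a b i j j' ha hb hj
    rw [htrans _ a ha, htrans _ b hb]
    have h1 := (hv ⟨i, j⟩ ⟨a, ha⟩).2.2.1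
    have h2 := (hv ⟨i, j'⟩ ⟨b, hb⟩).2.2.2
    have h3 : pos (ow ⟨i, j.succ⟩) ≤ pos (ow ⟨i, j'.castSucc⟩) :=
      how.mono i (show j.succ ≤ j'.castSucc from Fin.le_def.2 hj)
    have h4 := j'.2
    have h5 : (j : ℕ) < j' := hj
    simp only at h1 h2
    omega
  refine ⟨fun a => v (q a) ⟨a, rfl⟩, fun a => (hv _ _).1, fun a b hab hc => ?_⟩
  have hi : (q a).1 = (q b).1 := by
    rw [(hv _ _).2.1, (hv _ _).2.1] at hc
    exact how.comp_eq_iff.1 hc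
  obtain ⟨i, j, ha⟩ : ∃ i j, q a = ⟨i, j⟩ := ⟨_, _, rfl⟩
  obtain ⟨i', j', hb⟩ : ∃ i j, q b = ⟨i, j⟩ := ⟨_, _, rfl⟩
  obtain rfl : i = i' := by simpa [ha, hb] using hi
  rcases lt_trichotomy j j' with hj | rfl | hj
  · exact Or.inl (key a b i j j' ha hb hj)
  · simp only [htrans _ a ha, htrans _ b hb]
    exact hsep _ _ _ fun h => hab (congrArg Subtype.val h)
  · exact Or.inr (key b a i j' j hb ha hj)

theorem isInducedSubgraph_replicate {n : ℕ} {v : Fin n → (ofList P).V}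
    (hw : ∀ a, (ofList P).w (v a) = -2)
    (hv : ∀ a b, a ≠ b → comp (v a) = comp (v b) →
      pos (v a) + 1 < pos (v b) ∨ pos (v b) + 1 < pos (v a)) :
    IsInducedSubgraph (ofList (List.replicate n [(-2 : ℤ)])) (ofList P) := by
  have hget : ∀ i, (List.replicate n [(-2 : ℤ)]).get i = [-2] := fun i => by simp
  have hpos : ∀ x : (ofList (List.replicate n [(-2 : ℤ)])).V, pos x = 0 := by
    intro x
    have := pos_lt x
    rw [hget] at this
    exact Nat.lt_one_iff.1 this
  have hlen : (List.replicate n [(-2 : ℤ)]).length = n := List.length_replicate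
  refine ⟨fun x => v (Fin.cast hlen (comp x)), fun x y hxy => ?_, fun x => ?_, fun x y => ?_⟩
  · by_contra hne
    have hne' : Fin.cast hlen (comp x) ≠ Fin.cast hlen (comp y) := fun h =>
      hne (vertex_ext (Fin.cast_injective hlen h) (by rw [hpos, hpos]))
    have h := hv _ _ hne' (congrArg comp hxy)
    simp only at hxy
    rw [hxy] at h
    omega
  · have h : (ofList (List.replicate n [(-2 : ℤ)])).w x ∈
        (List.replicate n [(-2 : ℤ)]).get (comp x) := List.getElem_mem (pos_lt x)
    rw [hget, List.mem_singleton] at h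
    rw [h, hw]
  · rw [adj_iff, adj_iff, hpos, hpos]
    refine ⟨fun h => by omega, fun ⟨hc, h⟩ => ?_⟩
    exfalso
    simp only at hc h
    by_cases hxy : comp x = comp y
    · rw [hxy] at h
      omega
    · have := hv _ _ (fun h' => hxy (Fin.cast_injective hlen h')) hc
      omega

theorem exists_isRemovable (how : IsSlotMap P D ow) (hX : IsPlacing P N ow X)
    (hw : ∀ v, (ofList P).w v ≤ -2) {n : ℕ}
    (hC : ¬ IsInducedSubgraph (ofList (List.replicate n [(-2 : ℤ)])) (ofList P))
    (hn : n ≤ {v : (ofList P).V | (ofList P).IsDeep v}.ncard) :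
    ∃ g O, (ofList P).IsDeep g ∧ IsRemovable ow X g O := by
  by_contra! hcon
  obtain ⟨e⟩ : Nonempty (Fin n ↪ {v : (ofList P).V | (ofList P).IsDeep v}) := by
    have := Fintype.ofFinite {v : (ofList P).V | (ofList P).IsDeep v}
    refine Function.Embedding.nonempty_of_card_le ?_
    rw [Fintype.card_fin, ← Nat.card_eq_fintype_card]
    exact hn
  choose O hO using fun a => hX.exists_orthon hw (e a).2
  choose q hq using fun a => how.exists_blocks hX hw (e a).2 (hO a) (hcon _ (O a) (e a).2)
  obtain ⟨χ, hχ, hsep⟩ := how.exists_twos hX hw (γ := fun a => (e a : (ofList P).V))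
    (fun a b h => e.injective (Subtype.ext h)) (fun a => (e a).2) hq
  exact hC (isInducedSubgraph_replicate hχ hsep)

end Finale

theorem IsDualPair.exists_deep_failsX {P D : List (List ℤ)} {k n : ℕ} (hdual : IsDualPair P D)
    (hfail : FailsX k P D)
    (hC : ¬ IsInducedSubgraph (ofList (List.replicate n [(-2 : ℤ)])) (ofList P))
    (hn : n ≤ {v : (ofList P).V | (ofList P).IsDeep v}.ncard) :
    ∃ g : (ofList P).V, (ofList P).IsDeep g ∧
      ∀ P' D' : List (List ℤ), IsDualPair P' D' →
        IsInducedOn (ofList P') (ofList P) {g}ᶜ → FailsX k P' D' := by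
  obtain ⟨hk, φ, hφ⟩ := hfail
  obtain ⟨ow, how⟩ := hdual.exists_slots
  obtain ⟨X, hX⟩ := how.exists_placing hφ
  obtain ⟨g, O, hg, hO⟩ := exists_isRemovable how hX hdual.w_le hC hn
  refine ⟨g, hg, fun P' D' h' ⟨f, hinj, hw, hadj, hrange⟩ => ?_⟩
  have h3 := hX.three_le_card hdual.w_le hg
  obtain ⟨⟨t, ht⟩⟩ := (Nat.card_pos_iff.1 (show 0 < Nat.card {s // ow s = g} by omega)).1
  exact failsX_of_isRemovable hdual h' how hk hX ⟨t, ht⟩ hO ⟨hinj, hw, hadj, hrange⟩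

section Cut

variable {P : List (List ℤ)} {g : (ofList P).V}

/-- The position at which a segment left over after deleting `g` starts. -/
def cutStart (g : (ofList P).V) (r : Fin P.length × Bool) : ℕ :=
  if r.2 then pos g + 1 else 0

/-- The segments left over after deleting `g`: its component is cut in two, the others stay as
they are. -/
def cutSegment (g : (ofList P).V) (r : Fin P.length × Bool) : List ℤ :=
  if r.1 = comp g then if r.2 then (P.get r.1).drop (pos g + 1) else (P.get r.1).take (pos g)
  else if r.2 then [] else P.get r.1

theorem cutStart_add_lt {r : Fin P.length × Bool} {j : ℕ} (hj : j < (cutSegment g r).length) :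
    ∃ h : cutStart g r + j < (P.get r.1).length,
      (cutSegment g r)[j] = (P.get r.1)[cutStart g r + j] := by
  obtain ⟨i, b⟩ := r
  have hj' := hj
  unfold cutSegment cutStart at *
  by_cases hi : i = comp g <;> cases b <;> simp [hi] at hj' <;>
    simp [hi, List.getElem_take, List.getElem_drop] <;> omega

theorem cutStart_cases {r : Fin P.length × Bool} {j : ℕ} (hj : j < (cutSegment g r).length) :
    (r.1 ≠ comp g ∧ r.2 = false) ∨
      (r.1 = comp g ∧ ((r.2 = false ∧ cutStart g r + j < pos g) ∨
        (r.2 = true ∧ pos g < cutStart g r + j))) := by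
  obtain ⟨i, b⟩ := r
  unfold cutSegment cutStart at *
  by_cases hi : i = comp g <;> cases b <;> simp_all
  omega

theorem exists_cutStart_add {v : (ofList P).V} (hv : v ≠ g) :
    ∃ b j, j < (cutSegment g (comp v, b)).length ∧ cutStart g (comp v, b) + j = pos v := by
  have h := pos_lt v
  by_cases hc : comp v = comp g
  · have hp : pos v ≠ pos g := fun hp => hv (vertex_ext hc hp)
    rcases lt_or_gt_of_ne hp with hp | hp
    · refine ⟨false, pos v, ?_, by simp [cutStart]⟩
      simp only [cutSegment, if_pos hc, Bool.false_eq_true, if_false, List.length_take]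
      omega
    · refine ⟨true, pos v - (pos g + 1), ?_, by simp [cutStart]; omega⟩
      simp only [cutSegment, if_pos hc, if_true, List.length_drop]
      omega
  · exact ⟨false, pos v, by simpa [cutSegment, hc] using h, by simp [cutStart]⟩

variable (g) in
theorem exists_isInducedOn_compl :
    ∃ P' : List (List ℤ), (∀ p ∈ P', p ≠ []) ∧ IsInducedOn (ofList P') (ofList P) {g}ᶜ := by
  classical
  let R := {r : Fin P.length × Bool // cutSegment g r ≠ []}
  let e := (Fintype.equivFin R).symm
  let P' := List.ofFn fun a => cutSegment g (e a)
  have hlen : P'.length = Fintype.card R := List.length_ofFn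
  let ρ : Fin P'.length → R := fun i => e (Fin.cast hlen i)
  have hρ : Function.Injective ρ := e.injective.comp (Fin.cast_injective hlen)
  have hget : ∀ i, P'.get i = cutSegment g (ρ i) := fun i => List.get_ofFn _ _
  have hlt : ∀ x : (ofList P').V, pos x < (cutSegment g (ρ (comp x))).length := fun x =>
    hget (comp x) ▸ pos_lt x
  let f : (ofList P').V → (ofList P).V := fun x =>
    mkV (ρ (comp x)).1.1 (cutStart g (ρ (comp x)) + pos x) (cutStart_add_lt (hlt x)).1
  have hcomp : ∀ x, comp (f x) = (ρ (comp x)).1.1 := fun x => rfl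
  have hpos : ∀ x, pos (f x) = cutStart g (ρ (comp x)) + pos x := fun x => rfl
  have key : ∀ x y, comp (f x) = comp (f y) → comp x = comp y ∨
      (pos (f x) < pos g ∧ pos g < pos (f y)) ∨ (pos (f y) < pos g ∧ pos g < pos (f x)) := by
    intro x y hxy
    rw [hcomp, hcomp] at hxy
    have hx := cutStart_cases (hlt x)
    have hy := cutStart_cases (hlt y)
    rw [hpos, hpos]
    by_cases hb : (ρ (comp x)).1.2 = (ρ (comp y)).1.2
    · exact Or.inl (hρ (Subtype.ext (Prod.ext hxy hb)))
    · right
      rw [← hxy] at hy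
      rcases hx with ⟨h, hx⟩ | ⟨h, ⟨hx, h'⟩ | ⟨hx, h'⟩⟩ <;>
        rcases hy with ⟨k, hy⟩ | ⟨k, ⟨hy, k'⟩ | ⟨hy, k'⟩⟩ <;>
        first
          | exact absurd (hx.trans hy.symm) hb
          | exact absurd h k
          | exact absurd k h
          | exact Or.inl ⟨h', k'⟩
          | exact Or.inr ⟨k', h'⟩
  refine ⟨P', ?_, f, fun x y hxy => ?_, fun x => ?_, fun x y => ?_, ?_⟩
  · intro p hp
    obtain ⟨a, rfl⟩ := List.mem_ofFn.1 hp
    exact (e a).2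
  · rcases key x y (congrArg comp hxy) with h | h | h
    · refine vertex_ext h ?_
      have := congrArg pos hxy
      rw [hpos, hpos, h] at this
      omega
    · rw [hxy] at h
      omega
    · rw [hxy] at h
      omega
  · have := (cutStart_add_lt (hlt x)).2
    rw [w_eq, w_eq]
    simp only [hget]
    exact this.symm
  · rw [adj_iff, adj_iff]
    constructor
    · rintro ⟨hc, h⟩
      rw [hpos, hpos, hcomp, hcomp, hc]
      exact ⟨rfl, by omega⟩
    · rintro ⟨hc, h⟩
      rcases key x y hc with hk | hk | hk
      · rw [hpos, hpos, hk] at h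
        exact ⟨hk, by omega⟩
      · omega
      · omega
  · ext v
    simp only [Set.mem_range, Set.mem_compl_iff, Set.mem_singleton_iff]
    constructor
    · rintro ⟨x, rfl⟩ hx
      have h1 := cutStart_cases (hlt x)
      have h2 := congrArg comp hx
      have h3 := congrArg pos hx
      rw [hcomp] at h2
      rw [hpos] at h3
      rcases h1 with h1 | ⟨-, h1 | h1⟩
      · exact h1.1 h2
      · omega
      · omega
    · intro hv
      obtain ⟨b, j, hj, hjv⟩ := exists_cutStart_add hv
      let r : R := ⟨(comp v, b), List.ne_nil_of_length_pos (by omega)⟩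
      let i : Fin P'.length := Fin.cast hlen.symm (e.symm r)
      have hi : ρ i = r := e.apply_symm_apply r
      refine ⟨mkV i j (by rw [hget, hi]; exact hj), vertex_ext ?_ ?_⟩
      · rw [hcomp, comp_mkV, hi]
      · rw [hpos, comp_mkV, pos_mkV, hi]
        exact hjv

end Cut

theorem IsDualPair.of_map {P : List (List ℤ)} (hne : ∀ p ∈ P, p ≠ [])
    (hw : ∀ v, (ofList P).w v ≤ -2) :
    IsDualPair P (P.map fun p => dualList (p.map fun x => -x)) := by
  refine ⟨(List.length_map _).symm, fun i => ?_⟩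
  have : (P.map fun p => dualList (p.map fun x => -x)).get (Fin.cast (List.length_map _).symm i) =
      dualList ((P.get i).map fun x => -x) := by simp
  rw [this]
  refine dualSeqs_dualList (by simpa using hne _ (List.get_mem P i)) fun x hx => ?_
  obtain ⟨y, hy, rfl⟩ := List.mem_map.1 hx
  obtain ⟨j, hj, rfl⟩ := List.mem_iff_getElem.1 hy
  have := hw (mkV i j hj)
  have h : (ofList P).w (mkV i j hj) = (P.get i)[j] := rfl
  omega

end Auxiliary

/-- Lemma 6.5: a graph failing Property `X_k`, containing no `C_{k'}` and having at
least `k'` deep vertices has a deep vertex whose deletion again fails Property `X_k`;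
consequently, a minimal such graph has at most `k' - 1` deep vertices. -/
theorem statement16 (k k' : ℕ) (hk : 0 < k)
    (hk' : k' = if Even k then k else k + 1)
    (P D : List (List ℤ)) (hdual : IsDualPair P D)
    (hfail : FailsX k P D)
    (hC : ¬ IsInducedSubgraph (ofList (List.replicate k' [(-2 : ℤ)])) (ofList P)) :
    (k' ≤ {v : (ofList P).V | (ofList P).IsDeep v}.ncard →
      ∃ g : (ofList P).V, (ofList P).IsDeep g ∧
        ∀ P' D' : List (List ℤ), IsDualPair P' D' →
          IsInducedOn (ofList P') (ofList P) {g}ᶜ → FailsX k P' D') ∧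
    ((∀ S : Set (ofList P).V, S ≠ Set.univ →
        ∀ P' D' : List (List ℤ), IsDualPair P' D' →
          IsInducedOn (ofList P') (ofList P) S → ¬ FailsX k P' D') →
      {v : (ofList P).V | (ofList P).IsDeep v}.ncard ≤ k' - 1) := by
  refine ⟨fun hn => hdual.exists_deep_failsX hfail hC hn, fun hmin => ?_⟩
  by_contra! hn
  obtain ⟨g, -, hg⟩ := hdual.exists_deep_failsX hfail hC (by omega)
  obtain ⟨P', hne, hP'⟩ := exists_isInducedOn_compl g
  have hd : IsDualPair P' _ := IsDualPair.of_map hne fun v => by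
    obtain ⟨f, -, hw, -⟩ := hP'
    exact hw v ▸ hdual.w_le (f v)
  refine hmin {g}ᶜ (fun h => ?_) P' _ hd hP' (hg P' _ hd hP')
  exact (h ▸ Set.mem_univ g : g ∈ ({g}ᶜ : Set (ofList P).V)) rfl

end LensPaper
end

section
/- Let k be a positive integer, and set k' = k if k is even and k' = k + 1 if k is odd. If a canonical plumbing graph G contains no configuration of D_{k'} as an induced subgraph, then G has at most 6k' − 6 shallow vertices. -/
namespace LensPaper

namespace Config

/-- The pair `p` spans a configuration of `D_1`: a diagonal pair stands for a single vertex of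
weight `-2` or `-4`, any other one for two adjacent vertices of weight `-3`. -/
def IsPiece (G : Config) (p : G.V × G.V) : Prop :=
  (p.1 = p.2 ∧ (G.w p.1 = -2 ∨ G.w p.1 = -4)) ∨
  (G.graph.Adj p.1 p.2 ∧ G.w p.1 = -3 ∧ G.w p.2 = -3)

/-- No vertex of `p` is equal or adjacent to a vertex of `q`. -/
def Separated (G : Config) (p q : G.V × G.V) : Prop :=
  ∀ y z, (y = p.1 ∨ y = p.2) → (z = q.1 ∨ z = q.2) → y ≠ z ∧ ¬ G.graph.Adj y z

lemma Separated.symm {G : Config} {p q : G.V × G.V} (h : G.Separated p q) : G.Separated q p :=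
  fun y z hy hz => ⟨(h z y hz hy).1.symm, fun ha => (h z y hz hy).2 ha.symm⟩

/-- The list of weights of a piece. -/
def pieceWeights (G : Config) (p : G.V × G.V) : List ℤ :=
  if p.1 = p.2 then [G.w p.1] else [G.w p.1, G.w p.2]

/-- The `j`-th vertex of a pair. -/
def pieceVertex (G : Config) (p : G.V × G.V) (j : ℕ) : G.V :=
  if j = 0 then p.1 else p.2

lemma pieceVertex_mem (G : Config) (p : G.V × G.V) (j : ℕ) :
    G.pieceVertex p j = p.1 ∨ G.pieceVertex p j = p.2 := by
  unfold pieceVertex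
  split_ifs <;> simp

lemma w_pieceVertex (G : Config) (p : G.V × G.V) (c : List ℤ) (hc : c = G.pieceWeights p)
    (j : Fin c.length) : G.w (G.pieceVertex p j) = c.get j := by
  subst hc
  obtain ⟨j, hj⟩ := j
  unfold pieceWeights at hj
  unfold pieceVertex
  rcases j with _ | _ | j <;> grind [pieceWeights]

lemma pieceVertex_inj (G : Config) (p : G.V × G.V) {i j : ℕ}
    (hi : i < (G.pieceWeights p).length) (hj : j < (G.pieceWeights p).length)
    (h : G.pieceVertex p i = G.pieceVertex p j) : i = j := by
  unfold pieceWeights at hi hj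
  unfold pieceVertex at h
  grind

lemma IsPiece.adj_pieceVertex_iff {G : Config} {p : G.V × G.V} (hp : G.IsPiece p) {i j : ℕ}
    (hi : i < (G.pieceWeights p).length) (hj : j < (G.pieceWeights p).length) :
    G.graph.Adj (G.pieceVertex p i) (G.pieceVertex p j) ↔ i + 1 = j ∨ j + 1 = i := by
  have h1 := G.graph.loopless.irrefl p.1
  have h2 := G.graph.loopless.irrefl p.2
  have h3 := G.graph.adj_comm p.1 p.2
  unfold pieceWeights at hi hj
  unfold pieceVertex
  unfold IsPiece at hp
  grind

lemma IsPiece.pieceWeights_eq {G : Config} {p : G.V × G.V} (hp : G.IsPiece p) :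
    G.pieceWeights p = [-2] ∨ G.pieceWeights p = [-4] ∨ G.pieceWeights p = [-3, -3] := by
  unfold pieceWeights
  rcases hp with ⟨h, h'⟩ | ⟨h, h1, h2⟩
  · rcases h' with h' | h' <;> simp [h, h ▸ h']
  · simp [h.ne, h1, h2]

/-- A pairwise separated list of pieces is an induced subgraph. -/
lemma isInducedSubgraph_of_pieces (G : Config) (F : List (G.V × G.V))
    (hF : ∀ p ∈ F, G.IsPiece p) (hsep : F.Pairwise G.Separated) :
    IsInducedSubgraph (ofList (F.map G.pieceWeights)) G := by
  have hlt (i : Fin (F.map G.pieceWeights).length) : i.1 < F.length := by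
    simpa using i.2
  have hget (i : Fin (F.map G.pieceWeights).length) :
      (F.map G.pieceWeights).get i = G.pieceWeights (F[i.1]'(hlt i)) := by simp
  have hsep' (i j : Fin (F.map G.pieceWeights).length) (hij : i ≠ j) :
      G.Separated (F[i.1]'(hlt i)) (F[j.1]'(hlt j)) := by
    rw [List.pairwise_iff_getElem] at hsep
    rcases lt_or_gt_of_ne (Fin.val_ne_of_ne hij) with h | h
    · exact hsep _ _ _ _ h
    · exact (hsep _ _ _ _ h).symm
  refine ⟨fun a => G.pieceVertex (F[a.1.1]'(hlt a.1)) a.2.1, ?_, ?_, ?_⟩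
  · rintro ⟨i, a⟩ ⟨j, b⟩ h
    dsimp only at h
    by_cases hij : i = j
    · subst hij
      have := G.pieceVertex_inj _ (hget i ▸ a.2) (hget i ▸ b.2) h
      rw [Fin.ext this]
    · exact absurd h
        (hsep' i j hij _ _ (G.pieceVertex_mem _ _) (G.pieceVertex_mem _ _)).1
  · rintro ⟨i, a⟩
    exact G.w_pieceVertex _ _ (hget i) a
  · rintro ⟨i, a⟩ ⟨j, b⟩
    change (i = j ∧ (a.1 + 1 = b.1 ∨ b.1 + 1 = a.1)) ↔
      G.graph.Adj (G.pieceVertex (F[i.1]'(hlt i)) a.1) (G.pieceVertex (F[j.1]'(hlt j)) b.1)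
    by_cases hij : i = j
    · subst hij
      rw [(hF _ (List.getElem_mem _)).adj_pieceVertex_iff (hget i ▸ a.2) (hget i ▸ b.2)]
      simp
    · simp only [hij, false_and, false_iff]
      exact (hsep' i j hij _ _ (G.pieceVertex_mem _ _) (G.pieceVertex_mem _ _)).2

/-- `x` is at distance at most two from a vertex of `p`. -/
def Near (G : Config) (p : G.V × G.V) (x : G.V) : Prop :=
  ∃ z y, (z = p.1 ∨ z = p.2) ∧ (y = z ∨ G.graph.Adj z y) ∧ (x = y ∨ G.graph.Adj y x)

/-- A vertex `u` of degree at most two with a neighbour `v` has at most one further neighbour. -/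
lemma exists_other_neighbor (G : Config) {u v : G.V} (hu : G.deg u ≤ 2)
    (huv : G.graph.Adj u v) : ∃ a, ∀ x, G.graph.Adj u x → x = v ∨ x = a := by
  by_contra! h
  obtain ⟨x, hx, hxv, -⟩ := h v
  obtain ⟨y, hy, hyv, hyx⟩ := h x
  have hsub : (({v, x, y} : Finset G.V) : Set G.V) ⊆ G.graph.neighborSet u := by
    intro z hz
    simp only [Finset.coe_insert, Finset.coe_singleton, Set.mem_insert_iff,
      Set.mem_singleton_iff] at hz
    rcases hz with rfl | rfl | rfl <;> assumption
  have hle := Set.ncard_le_ncard hsub (Set.toFinite _)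
  rw [Set.ncard_coe_finset, Finset.card_eq_three.2 ⟨v, x, y, hxv.symm, hyv.symm, hyx.symm, rfl⟩]
    at hle
  unfold deg at hu
  omega

/-- Walking away from `v` through its neighbour `u`, the two next vertices are determined. -/
lemma exists_tail (G : Config) (hdeg : ∀ v, G.deg v ≤ 2) {u v : G.V}
    (huv : G.graph.Adj u v) :
    ∃ a a', ∀ x, G.graph.Adj u x → x = v ∨ (x = a ∧ ∀ y, G.graph.Adj x y → y = u ∨ y = a') := by
  obtain ⟨a, ha⟩ := G.exists_other_neighbor (hdeg u) huv
  by_cases hua : G.graph.Adj u a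
  · obtain ⟨a', ha'⟩ := G.exists_other_neighbor (hdeg a) hua.symm
    exact ⟨a, a', fun x hx => (ha x hx).imp_right fun h => ⟨h, h ▸ ha'⟩⟩
  · exact ⟨a, a, fun x hx => (ha x hx).imp_right fun h => absurd (h ▸ hx) hua⟩

lemma exists_finset_near_of_adj (G : Config) (hdeg : ∀ v, G.deg v ≤ 2) {u v : G.V}
    (huv : G.graph.Adj u v) :
    ∃ S : Finset G.V, S.card ≤ 6 ∧ ∀ x, G.Near (u, v) x → x ∈ S := by
  obtain ⟨a, a', ha⟩ := G.exists_tail hdeg huv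
  obtain ⟨b, b', hb⟩ := G.exists_tail hdeg huv.symm
  refine ⟨{u, v, a, a', b, b'}, Finset.card_le_six, ?_⟩
  rintro x ⟨z, y, hz, hy, hx⟩
  simp only [Finset.mem_insert, Finset.mem_singleton]
  dsimp only at hz
  grind

lemma IsPiece.exists_finset_near {G : Config} (hdeg : ∀ v, G.deg v ≤ 2) {p : G.V × G.V}
    (hp : G.IsPiece p) :
    ∃ S : Finset G.V, S.card ≤ 6 ∧ ∀ x, G.Near p x → x ∈ S := by
  obtain ⟨u, v⟩ := p
  rcases hp with ⟨h, -⟩ | ⟨h, -⟩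
  · dsimp only at h
    subst h
    by_cases hu : ∃ v, G.graph.Adj u v
    · obtain ⟨v, hv⟩ := hu
      obtain ⟨S, hS, hS'⟩ := G.exists_finset_near_of_adj hdeg hv
      refine ⟨S, hS, ?_⟩
      rintro x ⟨z, y, hz, hyx⟩
      exact hS' x ⟨z, y, Or.inl (by simpa using hz), hyx⟩
    · push Not at hu
      refine ⟨{u}, by simp, ?_⟩
      rintro x ⟨z, y, hz, hy, hx⟩
      dsimp only at hz
      grind
  · exact G.exists_finset_near_of_adj hdeg h

/-- For every shallow vertex there is a piece all of whose vertices are equal or adjacent to it. -/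
lemma IsShallow.exists_piece {G : Config} {v : G.V} (hv : G.IsShallow v) :
    ∃ q, G.IsPiece q ∧ ∀ z, (z = q.1 ∨ z = q.2) → v = z ∨ G.graph.Adj z v := by
  rcases hv with h | h | ⟨h, u, huv, hu⟩ | ⟨h, u, huv, hu⟩
  · exact ⟨(v, v), Or.inl ⟨rfl, Or.inl h⟩, by simp +contextual⟩
  · exact ⟨(v, v), Or.inl ⟨rfl, Or.inr h⟩, by simp +contextual⟩
  · exact ⟨(u, u), Or.inl ⟨rfl, Or.inl hu⟩, by simp +contextual [huv.symm]⟩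
  · refine ⟨(v, u), Or.inr ⟨huv, h, hu⟩, ?_⟩
    rintro z (rfl | rfl)
    · exact Or.inl rfl
    · exact Or.inr huv.symm

/-- If no piece is separated from all members of `F`, then every shallow vertex is close to a
member of `F`. -/
lemma ncard_shallow_le (G : Config) (hdeg : ∀ v, G.deg v ≤ 2) (F : List (G.V × G.V))
    (hF : ∀ p ∈ F, G.IsPiece p)
    (hmax : ∀ q, G.IsPiece q → ∃ p ∈ F, ¬ G.Separated q p) :
    {v : G.V | G.IsShallow v}.ncard ≤ 6 * F.length := by
  have hS (p : G.V × G.V) :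
      ∃ S : Finset G.V, S.card ≤ 6 ∧ (p ∈ F → ∀ x, G.Near p x → x ∈ S) := by
    by_cases hp : p ∈ F
    · obtain ⟨S, h, h'⟩ := (hF p hp).exists_finset_near hdeg
      exact ⟨S, h, fun _ => h'⟩
    · exact ⟨∅, by simp, fun h => absurd h hp⟩
  choose S hcard hnear using hS
  have hsub : {v : G.V | G.IsShallow v} ⊆ (F.toFinset.biUnion S : Set G.V) := by
    intro v hv
    obtain ⟨q, hq, hqv⟩ := IsShallow.exists_piece hv
    obtain ⟨p, hp, hpq⟩ := hmax q hq
    unfold Separated at hpq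
    push Not at hpq
    obtain ⟨z, y, hz, hy, hzy⟩ := hpq
    simp only [Finset.coe_biUnion, Set.mem_iUnion]
    refine ⟨p, by simpa using hp, hnear p hp v ⟨y, z, hy, ?_, hqv z hz⟩⟩
    by_cases h : z = y
    · exact Or.inl h
    · exact Or.inr (hzy h).symm
  have h1 := Set.ncard_le_ncard hsub (Set.toFinite _)
  rw [Set.ncard_coe_finset] at h1
  have h2 := Finset.card_biUnion_le_card_mul F.toFinset S 6 fun p _ => hcard p
  have h3 := F.toFinset_card_le
  omega

lemma exists_pieces_or_ncard_shallow_le (G : Config) (hdeg : ∀ v, G.deg v ≤ 2) (n : ℕ) :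
    (∃ F : List (G.V × G.V), F.length = n ∧ (∀ p ∈ F, G.IsPiece p) ∧
      F.Pairwise G.Separated) ∨ {v : G.V | G.IsShallow v}.ncard ≤ 6 * n - 6 := by
  induction n with
  | zero => exact Or.inl ⟨[], by simp⟩
  | succ n ih =>
    rcases ih with ⟨F, hlen, hF, hsep⟩ | h
    · by_cases hq : ∃ q, G.IsPiece q ∧ ∀ p ∈ F, G.Separated q p
      · obtain ⟨q, hq, hqF⟩ := hq
        exact Or.inl ⟨q :: F, by simp [hlen], by simpa using ⟨hq, fun a b => hF (a, b)⟩,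
          List.pairwise_cons.2 ⟨hqF, hsep⟩⟩
      · push Not at hq
        have := G.ncard_shallow_le hdeg F hF hq
        right
        omega
    · right
      omega

end Config

/-- Lemma 6.6: a canonical plumbing graph containing no configuration of `D_{k'}` as an
induced subgraph has at most `6k' - 6` shallow vertices. -/
theorem statement17 (k k' : ℕ) (hk : 0 < k)
    (hk' : k' = if Even k then k else k + 1)
    (G : Config) (hlin : G.IsLinear) (hneg : ∀ v : G.V, G.w v ≤ -2)
    (hD : ∀ comps : List (List ℤ), comps.length = k' →
      (∀ c ∈ comps, c = [(-2 : ℤ)] ∨ c = [(-4 : ℤ)] ∨ c = [(-3 : ℤ), (-3 : ℤ)]) →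
      ¬ IsInducedSubgraph (ofList comps) G) :
    {v : G.V | G.IsShallow v}.ncard ≤ 6 * k' - 6 := by
  rcases G.exists_pieces_or_ncard_shallow_le hlin.1 k' with ⟨F, hlen, hF, hsep⟩ | h
  · refine absurd (G.isInducedSubgraph_of_pieces F hF hsep) (hD _ (by simpa using hlen) ?_)
    intro c hc
    obtain ⟨p, hp, rfl⟩ := List.mem_map.1 hc
    exact (hF p hp).pieceWeights_eq
  · exact h

end LensPaper
end
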